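/- arXiv:1409.6229 — 2 statements merged into one kernel-verified Lean document; each statement's English description precedes it below -/
import Mathlib

section
/- Fix λ ∈ ℝ \ {0} and A > 0. Let q be an admissible potential on (0,A) equipped with a normalized fundamental system, with associated characteristic function Δ and function δ. Then, as μ → +∞ along the positive real axis, Δ(μ)·μ^{−2iλ}·e^{−μA} → Γ(1−iλ)²·2^{−2iλ}/π and δ(μ)·e^{−μA} → Γ(1−iλ)·Γ(1+iλ)/(2iλπ), where complex powers are principal-branch powers and Γ is the complex Gamma function. -/
open Filter MeasureTheory Topology

/-- `u` is a twice continuously differentiable solution of `−u'' + q u = −μ² u`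
on `(0,A)`. -/
def SolvesRadialODE (A : ℝ) (q : ℝ → ℂ) (μ : ℂ) (u : ℝ → ℂ) : Prop :=
  ∀ x ∈ Set.Ioo (0 : ℝ) A,
    DifferentiableAt ℝ u x ∧ DifferentiableAt ℝ (deriv u) x ∧
    ContinuousAt (deriv (deriv u)) x ∧
    -(deriv (deriv u) x) + q x * u x = -μ ^ 2 * u x

/-- An admissible potential on `(0,A)`: continuous, with regular singularities
`(−λ²−1/4)/x²` at `x = 0` and `(−λ²−1/4)/(A−x)²` at `x = A` and integrable
perturbations. -/
def IsAdmissible (lam A : ℝ) (q : ℝ → ℂ) : Prop :=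
  ContinuousOn q (Set.Ioo 0 A) ∧
  (∃ q₀ : ℝ → ℂ,
    (∀ x ∈ Set.Ioo (0 : ℝ) A,
      q x = (-(lam : ℂ) ^ 2 - 1/4) / (x : ℂ) ^ 2 + q₀ x) ∧
    IntegrableOn (fun t : ℝ => t * ‖q₀ t‖) (Set.Ioo 0 (A/2))) ∧
  (∃ q₁ : ℝ → ℂ,
    (∀ x ∈ Set.Ioo (0 : ℝ) A,
      q x = (-(lam : ℂ) ^ 2 - 1/4) / ((A : ℂ) - (x : ℂ)) ^ 2 + q₁ x) ∧
    IntegrableOn (fun t : ℝ => (A - t) * ‖q₁ t‖) (Set.Ioo (A/2) A))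

/-- A normalized fundamental system `(S₁₀, S₂₀, S₁₁)` for an admissible potential:
solutions of the radial ODE, entire and even in `μ`, with normalized asymptotics
`S₁₀ ∼ x^{1/2−iλ}`, `S₂₀ ∼ (1/(2iλ))x^{1/2+iλ}` at `x = 0` and
`S₁₁ ∼ (A−x)^{1/2−iλ}` at `x = A`. -/
def IsNormalizedFS (lam A : ℝ) (q : ℝ → ℂ) (S10 S20 S11 : ℝ → ℂ → ℂ) : Prop :=
  (∀ μ : ℂ, SolvesRadialODE A q μ (fun x => S10 x μ) ∧
            SolvesRadialODE A q μ (fun x => S20 x μ) ∧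
            SolvesRadialODE A q μ (fun x => S11 x μ)) ∧
  (∀ x ∈ Set.Ioo (0 : ℝ) A,
    (Differentiable ℂ (S10 x) ∧ ∀ μ : ℂ, S10 x μ = S10 x (-μ)) ∧
    (Differentiable ℂ (S20 x) ∧ ∀ μ : ℂ, S20 x μ = S20 x (-μ)) ∧
    (Differentiable ℂ (S11 x) ∧ ∀ μ : ℂ, S11 x μ = S11 x (-μ))) ∧
  (∀ μ : ℂ,
    Tendsto (fun x : ℝ => S10 x μ * (x : ℂ) ^ ((-1/2 : ℂ) + Complex.I * lam))
      (𝓝[>] 0) (𝓝 1) ∧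
    Tendsto (fun x : ℝ =>
        2 * Complex.I * lam * S20 x μ * (x : ℂ) ^ ((-1/2 : ℂ) - Complex.I * lam))
      (𝓝[>] 0) (𝓝 1) ∧
    Tendsto (fun x : ℝ =>
        S11 x μ * ((A : ℂ) - (x : ℂ)) ^ ((-1/2 : ℂ) + Complex.I * lam))
      (𝓝[<] A) (𝓝 1))

/-- The characteristic function `Δ(μ) = W(S₁₁, S₁₀)`, evaluated at the sample point
`x = A/2` (the Wronskian is independent of `x ∈ (0,A)`). -/
noncomputable def charFun (A : ℝ) (S10 S11 : ℝ → ℂ → ℂ) (μ : ℂ) : ℂ :=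
  S11 (A/2) μ * deriv (fun x => S10 x μ) (A/2) -
    deriv (fun x => S11 x μ) (A/2) * S10 (A/2) μ

/-- The function `δ(μ) = W(S₁₁, S₂₀)`, evaluated at the sample point `x = A/2`
(the Wronskian is independent of `x ∈ (0,A)`). -/
noncomputable def deltaFun (A : ℝ) (S20 S11 : ℝ → ℂ → ℂ) (μ : ℂ) : ℂ :=
  S11 (A/2) μ * deriv (fun x => S20 x μ) (A/2) -
    deriv (fun x => S11 x μ) (A/2) * S20 (A/2) μ

/-- The weight `(r(1-r))^(ν-1/2)` of the Poisson integral for the modified Bessel function. -/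
noncomputable def poissonWeight (ν : ℂ) (r : ℝ) : ℂ :=
  (r : ℂ) ^ ((ν + 1/2) - 1) * (1 - (r : ℂ)) ^ ((ν + 1/2) - 1)

/-- The `k`-th derivative of the Poisson integral `∫₀¹ (r(1-r))^(ν-1/2) e^{s(1-2r)} dr`. -/
noncomputable def poissonInt (ν : ℂ) (k : ℕ) (s : ℝ) : ℂ :=
  ∫ r in (0 : ℝ)..1, poissonWeight ν r * (((1 - 2 * r) ^ k * Real.exp (s * (1 - 2 * r)) : ℝ) : ℂ)

lemma poissonWeight_intervalIntegrable {ν : ℂ} (hν : ν.re = 0) :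
    IntervalIntegrable (poissonWeight ν) volume 0 1 := by
  have h : 0 < (ν + 1/2).re := by simp [hν]
  exact Complex.betaIntegral_convergent h h

lemma poissonInt_integrable {ν : ℂ} (hν : ν.re = 0) (k : ℕ) (s : ℝ) :
    IntervalIntegrable (fun r => poissonWeight ν r *
      (((1 - 2 * r) ^ k * Real.exp (s * (1 - 2 * r)) : ℝ) : ℂ)) volume 0 1 :=
  (poissonWeight_intervalIntegrable hν).mul_continuousOn (by fun_prop)

lemma hasDerivAt_poissonInt {ν : ℂ} (hν : ν.re = 0) (k : ℕ) (s : ℝ) :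
    HasDerivAt (poissonInt ν k) (poissonInt ν (k + 1) s) s := by
  have hI := poissonWeight_intervalIntegrable hν
  refine (intervalIntegral.hasDerivAt_integral_of_dominated_loc_of_deriv_le
    (F := fun x r => poissonWeight ν r * (((1 - 2 * r) ^ k * Real.exp (x * (1 - 2 * r)) : ℝ) : ℂ))
    (F' := fun x r => poissonWeight ν r *
      (((1 - 2 * r) ^ (k + 1) * Real.exp (x * (1 - 2 * r)) : ℝ) : ℂ))
    (bound := fun r => ‖poissonWeight ν r‖ * Real.exp (|s| + 1)) (Metric.ball_mem_nhds s one_pos)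
    (Eventually.of_forall fun x => ?_) (poissonInt_integrable hν k s) ?_ ?_ ?_ ?_).2
  · exact (poissonInt_integrable hν k x).def'.aestronglyMeasurable
  · exact (poissonInt_integrable hν (k + 1) s).def'.aestronglyMeasurable
  · refine Eventually.of_forall fun r hr x hx => ?_
    rw [Set.uIoc_of_le zero_le_one] at hr
    rw [norm_mul]
    gcongr
    rw [Complex.norm_real, Real.norm_eq_abs, abs_mul, Real.abs_exp, abs_pow]
    have h1 : |1 - 2 * r| ≤ 1 := abs_le.2 ⟨by linarith [hr.2], by linarith [hr.1]⟩
    have h2 : |x| ≤ |s| + 1 := by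
      have := abs_sub_abs_le_abs_sub x s
      rw [Metric.mem_ball, Real.dist_eq] at hx
      linarith
    have h3 : x * (1 - 2 * r) ≤ |s| + 1 := by
      calc x * (1 - 2 * r) ≤ |x * (1 - 2 * r)| := le_abs_self _
        _ = |x| * |1 - 2 * r| := abs_mul _ _
        _ ≤ |x| * 1 := by gcongr
        _ ≤ _ := by linarith
    calc _ ≤ 1 * Real.exp (|s| + 1) := by
          gcongr
          exact pow_le_one₀ (abs_nonneg _) h1
      _ = _ := one_mul _
  · exact hI.norm.mul_const _
  · refine Eventually.of_forall fun r _ x _ => ?_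
    have h1 : HasDerivAt (fun x : ℝ => (1 - 2 * r) ^ k * Real.exp (x * (1 - 2 * r)))
        ((1 - 2 * r) ^ (k + 1) * Real.exp (x * (1 - 2 * r))) x := by
      refine ((((hasDerivAt_id' x).mul_const (1 - 2 * r)).exp).const_mul
        ((1 - 2 * r) ^ k)).congr_deriv ?_
      ring
    exact (h1.ofReal_comp).const_mul _

lemma poissonInt_ode {ν : ℂ} (hν : ν.re = 0) (s : ℝ) :
    (s : ℂ) * poissonInt ν 2 s + (2 * ν + 1) * poissonInt ν 1 s - s * poissonInt ν 0 s = 0 := by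
  have hre : 0 < (ν + 1/2).re := by simp [hν]
  have hne : ν + 1/2 ≠ 0 := fun h => by rw [h] at hre; simp at hre
  have key := intervalIntegral.integral_eq_sub_of_hasDerivAt_of_le (a := 0) (b := 1)
    (f := fun r : ℝ => (r : ℂ) ^ (ν + 1/2) * (1 - (r : ℂ)) ^ (ν + 1/2) *
      ((Real.exp (s * (1 - 2 * r)) : ℝ) : ℂ))
    (f' := fun r : ℝ => poissonWeight ν r * (((1 - 2 * r) ^ 1 * Real.exp (s * (1 - 2 * r)) : ℝ) : ℂ)
        * (ν + 1/2) + (poissonWeight ν r *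
          (((1 - 2 * r) ^ 2 * Real.exp (s * (1 - 2 * r)) : ℝ) : ℂ) * (s / 2) -
        poissonWeight ν r * (((1 - 2 * r) ^ 0 * Real.exp (s * (1 - 2 * r)) : ℝ) : ℂ) * (s / 2)))
    zero_le_one ?_ ?_ ?_
  · rw [intervalIntegral.integral_add, intervalIntegral.integral_sub,
      intervalIntegral.integral_mul_const, intervalIntegral.integral_mul_const,
      intervalIntegral.integral_mul_const] at key
    · simp only [Complex.ofReal_zero, Complex.ofReal_one, sub_self, Complex.zero_cpow hne] at key
      simp only [poissonInt]
      linear_combination 2 * key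
    · exact (poissonInt_integrable hν 2 s).mul_const _
    · exact (poissonInt_integrable hν 0 s).mul_const _
    · exact (poissonInt_integrable hν 1 s).mul_const _
    · exact ((poissonInt_integrable hν 2 s).mul_const _).sub
        ((poissonInt_integrable hν 0 s).mul_const _)
  · have h1 : Continuous fun r : ℝ => (r : ℂ) ^ (ν + 1/2) :=
      Complex.continuous_ofReal_cpow_const hre
    have h2 : Continuous fun r : ℝ => (1 - (r : ℂ)) ^ (ν + 1/2) := by
      have := h1.comp (continuous_const.sub continuous_id : Continuous fun r : ℝ => 1 - r)
      simpa [Function.comp_def] using this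
    exact ((h1.mul h2).mul (by fun_prop)).continuousOn
  · intro r hr
    have h1 : HasDerivAt (fun r : ℝ => (r : ℂ) ^ (ν + 1/2))
        ((ν + 1/2) * (r : ℂ) ^ (ν + 1/2 - 1)) r := by
      simpa using ((hasDerivAt_id (r : ℂ)).cpow_const (c := ν + 1/2)
        (Complex.ofReal_mem_slitPlane.2 hr.1)).comp_ofReal
    have hr2 : (0 : ℝ) < 1 - r := by linarith [hr.2]
    have h2 : HasDerivAt (fun r : ℝ => (1 - (r : ℂ)) ^ (ν + 1/2))
        (-((ν + 1/2) * (1 - (r : ℂ)) ^ (ν + 1/2 - 1))) r := by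
      have hs : (1 - (r : ℂ)) ∈ Complex.slitPlane := by
        have := Complex.ofReal_mem_slitPlane.2 hr2
        simpa using this
      have := (((hasDerivAt_id (r : ℂ)).const_sub 1).cpow_const (c := ν + 1/2) hs).comp_ofReal
      simpa using this
    have h3 : HasDerivAt (fun r : ℝ => ((Real.exp (s * (1 - 2 * r)) : ℝ) : ℂ))
        (((Real.exp (s * (1 - 2 * r)) * (s * (-(2 * 1))) : ℝ)) : ℂ) r :=
      (((((hasDerivAt_id r).const_mul 2).const_sub 1).const_mul s).exp).ofReal_comp
    have hr0 : (r : ℂ) ≠ 0 := by exact_mod_cast hr.1.ne'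
    have hr1 : (1 - (r : ℂ)) ≠ 0 := by exact_mod_cast hr2.ne'
    have e1 : (r : ℂ) ^ (ν + 1/2) = (r : ℂ) ^ (ν + 1/2 - 1) * r := by
      rw [Complex.cpow_sub _ _ hr0, Complex.cpow_one]; field_simp
    have e2 : (1 - (r : ℂ)) ^ (ν + 1/2) = (1 - (r : ℂ)) ^ (ν + 1/2 - 1) * (1 - r) := by
      rw [Complex.cpow_sub _ _ hr1, Complex.cpow_one]; field_simp
    refine ((h1.mul h2).mul h3).congr_deriv ?_
    simp only [Pi.mul_apply, e1, e2, poissonWeight]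
    push_cast
    ring
  · exact ((poissonInt_integrable hν 1 s).mul_const _).add
      (((poissonInt_integrable hν 2 s).mul_const _).sub
        ((poissonInt_integrable hν 0 s).mul_const _))

lemma poissonInt_zero (ν : ℂ) :
    poissonInt ν 0 0 = Complex.betaIntegral (ν + 1/2) (ν + 1/2) := by
  simp [poissonInt, poissonWeight, Complex.betaIntegral]

lemma poissonInt_zero_mul {ν : ℂ} (hν : ν.re = 0) :
    Complex.Gamma (ν + 1/2) ^ 2 = Complex.Gamma (2 * ν + 1) * poissonInt ν 0 0 := by
  have hre : 0 < (ν + 1/2).re := by simp [hν]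
  rw [poissonInt_zero, sq, Complex.Gamma_mul_Gamma_eq_betaIntegral hre hre]
  ring_nf

lemma poissonInt_zero_ne_zero {ν : ℂ} (hν : ν.re = 0) : poissonInt ν 0 0 ≠ 0 := by
  intro h
  have := poissonInt_zero_mul hν
  rw [h, mul_zero] at this
  exact Complex.Gamma_ne_zero_of_re_pos (by simp [hν]) (pow_eq_zero_iff (two_ne_zero) |>.1 this)

lemma laplace_integral_tendsto {a : ℂ} (ha : a.re = 1/2) {g : ℝ → ℂ} {C : ℝ}
    (hgm : AEStronglyMeasurable g (volume.restrict (Set.Ioi 0)))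
    (hg1 : ∀ r ∈ Set.Ioo (0 : ℝ) 1, ‖g r - 1‖ ≤ C * (r * (1 - r) ^ (-1/2 : ℝ)))
    (hg0 : ∀ r : ℝ, 1 ≤ r → g r = 0) :
    Tendsto (fun S : ℝ => (S : ℂ) ^ a *
      ∫ r in Set.Ioi (0 : ℝ), (r : ℂ) ^ (a - 1) * g r * Complex.exp (-((S : ℂ) * r)))
      atTop (𝓝 (Complex.Gamma a)) := by
  have ha0 : 0 < a.re := by rw [ha]; norm_num
  set F : ℝ → ℝ → ℂ := fun S r => (S : ℂ) ^ a * ((r : ℂ) ^ (a - 1) * (g r - 1) *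
    Complex.exp (-((S : ℂ) * r))) with hF
  set bound : ℝ → ℝ := fun r => (Set.Ioo (0 : ℝ) 1).indicator
    (fun r => C * (1 - r) ^ (-1/2 : ℝ)) r + Real.exp (-(1/2) * r) with hbound
  have hpm : AEStronglyMeasurable (fun r : ℝ => (r : ℂ) ^ (a - 1))
      (volume.restrict (Set.Ioi 0)) := by
    refine ContinuousOn.aestronglyMeasurable (fun r hr => ?_) measurableSet_Ioi
    exact (Complex.continuousAt_ofReal_cpow_const _ _ (Or.inr (ne_of_gt hr))).continuousWithinAt
  have hem : ∀ S : ℝ, AEStronglyMeasurable (fun r : ℝ => Complex.exp (-((S : ℂ) * r)))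
      (volume.restrict (Set.Ioi 0)) := fun S =>
    (by fun_prop : Continuous fun r : ℝ => Complex.exp (-((S : ℂ) * r))).aestronglyMeasurable
  have hFm : ∀ S, AEStronglyMeasurable (F S) (volume.restrict (Set.Ioi 0)) := fun S =>
    ((hpm.mul (hgm.sub aestronglyMeasurable_const)).mul (hem S)).const_mul _
  have hnorm : ∀ S > 0, ∀ r > 0, ‖F S r‖ =
      S ^ (1/2 : ℝ) * (r ^ (-1/2 : ℝ) * ‖g r - 1‖ * Real.exp (-(S * r))) := by
    intro S hS r hr
    have e : (a - 1).re = -1/2 := by simp [ha]; norm_num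
    simp only [hF, norm_mul, Complex.norm_cpow_eq_rpow_re_of_pos hS,
      Complex.norm_cpow_eq_rpow_re_of_pos hr, ha, e]
    congr 2
    rw [Complex.norm_exp]
    simp
  have hle : ∀ S ≥ 1, ∀ r > 0, ‖F S r‖ ≤ bound r := by
    intro S hS r hr
    have hS0 : 0 < S := by linarith
    rw [hnorm S hS0 r hr]
    rcases lt_or_ge r 1 with h1 | h1
    · have hmem : r ∈ Set.Ioo (0 : ℝ) 1 := ⟨hr, h1⟩
      simp only [hbound, Set.indicator_of_mem hmem]
      have hx : (S * r) ^ (1/2 : ℝ) * Real.exp (-(S * r)) ≤ 1 := by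
        have h2 : (S * r) ^ (1/2 : ℝ) ≤ Real.exp (S * r) := by
          calc (S * r) ^ (1/2 : ℝ) ≤ Real.exp (S * r) ^ (1/2 : ℝ) := by
                gcongr
                linarith [Real.add_one_le_exp (S * r)]
            _ = Real.exp (S * r / 2) := by rw [← Real.exp_mul]; ring_nf
            _ ≤ _ := by
                gcongr
                have : 0 < S * r := by positivity
                linarith
        calc _ ≤ Real.exp (S * r) * Real.exp (-(S * r)) := by gcongr
          _ = 1 := by rw [← Real.exp_add]; simp
      have hC : 0 ≤ C * (1 - r) ^ (-1/2 : ℝ) := by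
        have h3 := (norm_nonneg _).trans (hg1 r hmem)
        have : C * (r * (1 - r) ^ (-1/2 : ℝ)) = r * (C * (1 - r) ^ (-1/2 : ℝ)) := by ring
        rw [this] at h3
        exact (mul_nonneg_iff_of_pos_left hr).1 h3
      have hrr : r ^ (-1/2 : ℝ) * r = r ^ (1/2 : ℝ) := by
        nth_rw 2 [← Real.rpow_one r]
        rw [← Real.rpow_add hr]; norm_num
      calc _ ≤ S ^ (1/2 : ℝ) * (r ^ (-1/2 : ℝ) * (C * (r * (1 - r) ^ (-1/2 : ℝ))) *
            Real.exp (-(S * r))) := by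
            gcongr
            exact hg1 r hmem
        _ = (S ^ (1/2 : ℝ) * (r ^ (-1/2 : ℝ) * r) * Real.exp (-(S * r))) *
            (C * (1 - r) ^ (-1/2 : ℝ)) := by ring
        _ = ((S * r) ^ (1/2 : ℝ) * Real.exp (-(S * r))) * (C * (1 - r) ^ (-1/2 : ℝ)) := by
            rw [hrr, Real.mul_rpow hS0.le hr.le]
        _ ≤ 1 * (C * (1 - r) ^ (-1/2 : ℝ)) := by gcongr
        _ ≤ _ := by
            rw [one_mul]
            linarith [Real.exp_pos (-(1/2) * r)]
    · have hmem : r ∉ Set.Ioo (0 : ℝ) 1 := fun h => absurd h.2 (not_lt.2 h1)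
      simp only [hbound, Set.indicator_of_notMem hmem, hg0 r h1, zero_add, zero_sub, norm_neg,
        norm_one, mul_one]
      have h2 : S ^ (1/2 : ℝ) ≤ Real.exp (S * r / 2) := by
        calc S ^ (1/2 : ℝ) ≤ Real.exp S ^ (1/2 : ℝ) := by
              gcongr
              linarith [Real.add_one_le_exp S]
          _ = Real.exp (S / 2) := by rw [← Real.exp_mul]; ring_nf
          _ ≤ _ := by
              gcongr
              nlinarith
      have h3 : r ^ (-1/2 : ℝ) ≤ 1 := Real.rpow_le_one_of_one_le_of_nonpos h1 (by norm_num)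
      calc _ ≤ Real.exp (S * r / 2) * (1 * Real.exp (-(S * r))) := by gcongr
        _ = Real.exp (-(S * r) / 2) := by rw [one_mul, ← Real.exp_add]; ring_nf
        _ ≤ _ := by
            gcongr
            nlinarith
  have hbi : IntegrableOn bound (Set.Ioi 0) := by
    refine Integrable.add ?_ (exp_neg_integrableOn_Ioi 0 (by norm_num))
    refine Integrable.integrableOn ?_
    rw [integrable_indicator_iff measurableSet_Ioo]
    have h1 : IntervalIntegrable (fun x : ℝ => x ^ (-1/2 : ℝ)) volume 0 1 :=
      intervalIntegral.intervalIntegrable_rpow' (by norm_num)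
    have h2 := (h1.comp_sub_left 1).symm
    simp only [sub_zero, sub_self] at h2
    exact ((intervalIntegrable_iff_integrableOn_Ioo_of_le zero_le_one).1 h2).const_mul C
  have hlim : Tendsto (fun S => ∫ r in Set.Ioi (0 : ℝ), F S r) atTop (𝓝 0) := by
    have := tendsto_integral_filter_of_dominated_convergence (μ := volume.restrict (Set.Ioi 0))
      (F := F) (f := fun _ => 0) (l := atTop) bound (Eventually.of_forall hFm) ?_ hbi ?_
    · simpa using this
    · filter_upwards [eventually_ge_atTop 1] with S hS
      filter_upwards [ae_restrict_mem measurableSet_Ioi] with r hr using hle S hS r hr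
    · filter_upwards [ae_restrict_mem measurableSet_Ioi] with r hr
      rw [tendsto_zero_iff_norm_tendsto_zero]
      have h1 := (tendsto_rpow_mul_exp_neg_mul_atTop_nhds_zero (1/2) r hr).mul_const
        (r ^ (-1/2 : ℝ) * ‖g r - 1‖)
      rw [zero_mul] at h1
      refine h1.congr' ?_
      filter_upwards [eventually_gt_atTop 0] with S hS
      rw [hnorm S hS r hr]
      ring_nf
  have hFi : ∀ S ≥ 1, IntegrableOn (F S) (Set.Ioi 0) := fun S hS =>
    Integrable.mono' hbi (hFm S) (by
      filter_upwards [ae_restrict_mem measurableSet_Ioi] with r hr using hle S hS r hr)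
  have h0i : ∀ S : ℝ, 1 ≤ S → IntegrableOn (fun r : ℝ => (S : ℂ) ^ a * ((r : ℂ) ^ (a - 1) *
      Complex.exp (-((S : ℂ) * r)))) (Set.Ioi 0) := by
    intro S hS
    refine Integrable.const_mul ?_ _
    refine Integrable.mono (Complex.GammaIntegral_convergent ha0) (hpm.mul (hem S)) ?_
    filter_upwards [ae_restrict_mem measurableSet_Ioi] with r hr
    rw [norm_mul, norm_mul, mul_comm]
    gcongr
    rw [Complex.norm_exp, Complex.norm_real, Real.norm_eq_abs, Real.abs_exp]
    have : (0 : ℝ) < r := hr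
    simp
    nlinarith
  have := hlim.add_const (Complex.Gamma a)
  rw [zero_add] at this
  refine this.congr' ?_
  filter_upwards [eventually_ge_atTop 1] with S hS
  have hS0 : 0 < S := by linarith
  have hSc : (S : ℂ) ≠ 0 := by exact_mod_cast hS0.ne'
  have e0 : Complex.Gamma a = ∫ r in Set.Ioi (0 : ℝ), (S : ℂ) ^ a * ((r : ℂ) ^ (a - 1) *
      Complex.exp (-((S : ℂ) * r))) := by
    rw [integral_const_mul, Complex.integral_cpow_mul_exp_neg_mul_Ioi ha0 hS0, ← mul_assoc,
      one_div, Complex.inv_cpow _ _ (by rw [Complex.arg_ofReal_of_nonneg hS0.le]; exact Real.pi_pos.ne),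
      mul_inv_cancel₀ (by simp [Complex.cpow_eq_zero_iff, hSc]), one_mul]
  rw [e0, ← integral_add (hFi S hS) (h0i S hS), ← integral_const_mul]
  refine integral_congr_ae (Eventually.of_forall fun r => ?_)
  simp only [hF]
  ring

lemma norm_one_sub_cpow_sub_one_le {b : ℂ} (hb : b.re = -1/2) :
    ∃ C : ℝ, 0 ≤ C ∧ ∀ r ∈ Set.Ioo (0 : ℝ) 1,
      ‖(1 - (r : ℂ)) ^ b - 1‖ ≤ C * (r * (1 - r) ^ (-1/2 : ℝ)) := by
  refine ⟨‖b‖ * (1/2) ^ (-3/2 : ℝ) + 4, by positivity, fun r hr => ?_⟩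
  have hone : 1 ≤ (1 - r) ^ (-1/2 : ℝ) :=
    Real.one_le_rpow_of_pos_of_le_one_of_nonpos (by linarith [hr.2]) (by linarith [hr.1])
      (by norm_num)
  rcases le_or_gt r (1/2) with h | h
  · have hd : ∀ x ∈ Set.Icc (0 : ℝ) (1/2), HasDerivWithinAt (fun x : ℝ => (1 - (x : ℂ)) ^ b)
        (-(b * (1 - (x : ℂ)) ^ (b - 1))) (Set.Icc 0 (1/2)) x := by
      intro x hx
      have hs : (1 - (x : ℂ)) ∈ Complex.slitPlane := by
        have := Complex.ofReal_mem_slitPlane.2 (show (0 : ℝ) < 1 - x by linarith [hx.2])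
        simpa using this
      have := (((hasDerivAt_id (x : ℂ)).const_sub 1).cpow_const (c := b) hs).comp_ofReal
      simpa using this.hasDerivWithinAt
    have hbd : ∀ x ∈ Set.Icc (0 : ℝ) (1/2), ‖-(b * (1 - (x : ℂ)) ^ (b - 1))‖ ≤
        ‖b‖ * (1/2) ^ (-3/2 : ℝ) := by
      intro x hx
      have hx1 : (0 : ℝ) < 1 - x := by linarith [hx.2]
      rw [norm_neg, norm_mul]
      gcongr
      have := Complex.norm_cpow_eq_rpow_re_of_pos hx1 (b - 1)
      push_cast at this
      rw [this]
      have e : (b - 1).re = -3/2 := by simp [hb]; norm_num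
      rw [e]
      exact Real.rpow_le_rpow_of_nonpos (by norm_num) (by linarith [hx.2]) (by norm_num)
    have := (convex_Icc (0 : ℝ) (1/2)).norm_image_sub_le_of_norm_hasDerivWithin_le hd hbd
      (show (0 : ℝ) ∈ Set.Icc (0 : ℝ) (1/2) by norm_num) (show r ∈ Set.Icc (0 : ℝ) (1/2) from
        ⟨hr.1.le, h⟩)
    simp only [Complex.ofReal_zero, sub_zero, Complex.one_cpow, Real.norm_eq_abs,
      abs_of_pos hr.1] at this
    have h0 : 0 ≤ ‖b‖ * (1/2) ^ (-3/2 : ℝ) := by positivity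
    have h4 : r ≤ r * (1 - r) ^ (-1/2 : ℝ) := le_mul_of_one_le_right hr.1.le hone
    calc _ ≤ ‖b‖ * (1/2) ^ (-3/2 : ℝ) * r := this
      _ ≤ (‖b‖ * (1/2) ^ (-3/2 : ℝ) + 4) * (r * (1 - r) ^ (-1/2 : ℝ)) := by
          have := hr.1.le
          gcongr
          linarith
  · have hx1 : (0 : ℝ) < 1 - r := by linarith [hr.2]
    have hn := Complex.norm_cpow_eq_rpow_re_of_pos hx1 b
    push_cast at hn
    rw [hb] at hn
    calc _ ≤ ‖(1 - (r : ℂ)) ^ b‖ + ‖(1 : ℂ)‖ := norm_sub_le _ _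
      _ = (1 - r) ^ (-1/2 : ℝ) + 1 := by rw [hn, norm_one]
      _ ≤ 4 * (r * (1 - r) ^ (-1/2 : ℝ)) := by nlinarith
      _ ≤ _ := by
          have : 0 ≤ r * (1 - r) ^ (-1/2 : ℝ) := by nlinarith [hr.1]
          have h0 : 0 ≤ ‖b‖ * (1/2) ^ (-3/2 : ℝ) := by positivity
          nlinarith

lemma poissonInt_tendsto {ν : ℂ} (hν : ν.re = 0) {k : ℕ} (hk : k ≤ 1) :
    Tendsto (fun s : ℝ => (2 * s : ℂ) ^ (ν + 1/2) * (poissonInt ν k s * Complex.exp (-s)))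
      atTop (𝓝 (Complex.Gamma (ν + 1/2))) := by
  have hb : (ν + 1/2 - 1).re = -1/2 := by simp [hν]; norm_num
  obtain ⟨C, hC0, hC⟩ := norm_one_sub_cpow_sub_one_le hb
  set g : ℝ → ℂ := (Set.Ioo (0 : ℝ) 1).indicator
    (fun r => (1 - (r : ℂ)) ^ (ν + 1/2 - 1) * (((1 - 2 * r) ^ k : ℝ) : ℂ)) with hg
  have hT := laplace_integral_tendsto (a := ν + 1/2) (g := g) (C := C + 2) (by simp [hν]) ?_ ?_ ?_
  · have hT2 := hT.comp (tendsto_id.const_mul_atTop (show (0 : ℝ) < 2 by norm_num))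
    refine hT2.congr fun s => ?_
    simp only [Function.comp, id, Complex.ofReal_mul, Complex.ofReal_ofNat]
    congr 1
    rw [poissonInt, intervalIntegral.integral_of_le zero_le_one,
      integral_Ioc_eq_integral_Ioo, ← integral_mul_const,
      ← integral_indicator measurableSet_Ioo, ← integral_indicator measurableSet_Ioi]
    congr 1
    ext r
    by_cases hr : r ∈ Set.Ioo (0 : ℝ) 1
    · rw [Set.indicator_of_mem hr, Set.indicator_of_mem (show r ∈ Set.Ioi 0 from hr.1), hg,
        Set.indicator_of_mem hr, poissonWeight]
      push_cast
      have : Complex.exp (-(2 * s * r)) = Complex.exp (s * (1 - 2 * r)) * Complex.exp (-s) := by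
        rw [← Complex.exp_add]; ring_nf
      rw [this]
      ring
    · rw [Set.indicator_of_notMem hr, hg]
      by_cases h0 : r ∈ Set.Ioi (0 : ℝ)
      · rw [Set.indicator_of_mem h0, Set.indicator_of_notMem hr]
        simp
      · rw [Set.indicator_of_notMem h0]
  · refine AEStronglyMeasurable.indicator ?_ measurableSet_Ioo
    refine Measurable.aestronglyMeasurable ?_
    fun_prop
  · intro r hr
    rw [hg, Set.indicator_of_mem hr]
    have hx1 : (0 : ℝ) < 1 - r := by linarith [hr.2]
    have hn := Complex.norm_cpow_eq_rpow_re_of_pos hx1 (ν + 1/2 - 1)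
    push_cast at hn
    rw [hb] at hn
    have h1 := hC r hr
    have hp : 0 ≤ (1 - r) ^ (-1/2 : ℝ) := by positivity
    interval_cases k
    · simp only [pow_zero, Complex.ofReal_one, mul_one]
      refine h1.trans ?_
      have := hr.1
      gcongr
      linarith
    · have e : (1 - (r : ℂ)) ^ (ν + 1/2 - 1) * (((1 - 2 * r) ^ 1 : ℝ) : ℂ) - 1 =
          ((1 - (r : ℂ)) ^ (ν + 1/2 - 1) - 1) -
            ((2 * r : ℝ) : ℂ) * (1 - (r : ℂ)) ^ (ν + 1/2 - 1) := by
        push_cast; ring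
      rw [e]
      refine (norm_sub_le _ _).trans ?_
      rw [norm_mul, hn, Complex.norm_real, Real.norm_eq_abs,
        abs_of_pos (show 0 < 2 * r by linarith [hr.1])]
      linarith
  · intro r hr
    rw [hg, Set.indicator_of_notMem (fun h => absurd h.2 (not_lt.2 hr))]

lemma norm_poissonInt_le {ν : ℂ} (hν : ν.re = 0) :
    ∃ C : ℝ, 0 < C ∧ (∀ s ∈ Set.Icc (0 : ℝ) 1, ‖poissonInt ν 0 s‖ ≤ C) ∧
      ∀ s : ℝ, 1 ≤ s → ‖poissonInt ν 0 s‖ ≤ C * s ^ (-1/2 : ℝ) * Real.exp s := by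
  have hcont : Continuous (poissonInt ν 0) :=
    continuous_iff_continuousAt.2 fun s => (hasDerivAt_poissonInt hν 0 s).continuousAt
  have hT := (poissonInt_tendsto hν (k := 0) (by norm_num)).norm
  obtain ⟨S, hS⟩ := eventually_atTop.1 (hT.eventually_le_const (lt_add_one _))
  obtain ⟨M, hM⟩ := (isCompact_Icc (a := (0 : ℝ)) (b := max S 1)).exists_bound_of_continuousOn
    hcont.continuousOn
  have hM0 : 0 ≤ M := (norm_nonneg _).trans (hM 0 ⟨le_rfl, by positivity⟩)
  set G := ‖Complex.Gamma (ν + 1/2)‖ + 1 with hG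
  have hG0 : 0 < G := by positivity
  refine ⟨M * (max S 1) ^ (1/2 : ℝ) + G + M, by positivity, fun s hs => ?_, fun s hs => ?_⟩
  · have := hM s ⟨hs.1, hs.2.trans (le_max_right _ _)⟩
    have h2 : 0 ≤ M * (max S 1) ^ (1/2 : ℝ) := by positivity
    linarith
  · have hs0 : 0 < s := by linarith
    have hpos : 0 < s ^ (-1/2 : ℝ) := by positivity
    have hcancel : s ^ (1/2 : ℝ) * s ^ (-1/2 : ℝ) = 1 := by
      rw [← Real.rpow_add hs0]; norm_num
    rcases le_total s (max S 1) with h | h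
    · have h1 := hM s ⟨hs0.le, h⟩
      have h2 : (1 : ℝ) ≤ (max S 1) ^ (1/2 : ℝ) * s ^ (-1/2 : ℝ) := by
        exact hcancel.symm.le.trans (by gcongr)
      have h3 : (1 : ℝ) ≤ Real.exp s := Real.one_le_exp hs0.le
      calc _ ≤ M := h1
        _ = M * 1 * 1 := by ring
        _ ≤ M * ((max S 1) ^ (1/2 : ℝ) * s ^ (-1/2 : ℝ)) * Real.exp s := by gcongr
        _ = (M * (max S 1) ^ (1/2 : ℝ)) * s ^ (-1/2 : ℝ) * Real.exp s := by ring
        _ ≤ _ := by gcongr; linarith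
    · have h1 := hS s ((le_max_left _ _).trans h)
      have h2s : (0 : ℝ) < 2 * s := by linarith
      have hn := Complex.norm_cpow_eq_rpow_re_of_pos h2s (ν + 1/2)
      push_cast at hn
      have e : (ν + 1/2).re = 1/2 := by simp [hν]
      rw [norm_mul, hn, e, norm_mul, Complex.norm_exp] at h1
      simp only [Complex.neg_re, Complex.ofReal_re] at h1
      have h3 : s ^ (1/2 : ℝ) ≤ (2 * s) ^ (1/2 : ℝ) := by gcongr; linarith
      have h4 : s ^ (1/2 : ℝ) * (‖poissonInt ν 0 s‖ * Real.exp (-s)) ≤ G :=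
        le_trans (by gcongr) h1
      have he : Real.exp (-s) * Real.exp s = 1 := by rw [← Real.exp_add]; simp
      calc ‖poissonInt ν 0 s‖ = (s ^ (1/2 : ℝ) * s ^ (-1/2 : ℝ)) * ‖poissonInt ν 0 s‖ *
            (Real.exp (-s) * Real.exp s) := by rw [hcancel, he]; ring
        _ = (s ^ (1/2 : ℝ) * (‖poissonInt ν 0 s‖ * Real.exp (-s))) * s ^ (-1/2 : ℝ) *
            Real.exp s := by ring
        _ ≤ G * s ^ (-1/2 : ℝ) * Real.exp s := by gcongr
        _ ≤ _ := by
            gcongr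
            have : 0 ≤ M * (max S 1) ^ (1/2 : ℝ) := by positivity
            linarith

/-- A differential Grönwall inequality on `(c, e]`, with the coefficients given by primitives. -/
lemma le_exp_mul_of_deriv_le {F B Γ F' b γ : ℝ → ℝ} {c e F0 : ℝ} (hce : c < e)
    (hFc : ContinuousOn F (Set.Ioc c e)) (hBc : ContinuousOn B (Set.Ioc c e))
    (hΓc : ContinuousOn Γ (Set.Ioc c e))
    (hF : ∀ x ∈ Set.Ioo c e, HasDerivAt F (F' x) x)
    (hB : ∀ x ∈ Set.Ioo c e, HasDerivAt B (b x) x)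
    (hΓ : ∀ x ∈ Set.Ioo c e, HasDerivAt Γ (γ x) x)
    (hle : ∀ x ∈ Set.Ioo c e, F' x ≤ b x * F x + γ x)
    (hB0 : ∀ x ∈ Set.Ioo c e, 0 ≤ B x) (hγ0 : ∀ x ∈ Set.Ioo c e, 0 ≤ γ x)
    (hFl : Tendsto F (𝓝[>] c) (𝓝 F0)) (hBl : Tendsto B (𝓝[>] c) (𝓝 0))
    (hΓl : Tendsto Γ (𝓝[>] c) (𝓝 0)) :
    F e ≤ Real.exp (B e) * (F0 + Γ e) := by
  have hd : ∀ x ∈ Set.Ioo c e, HasDerivAt (fun x => Real.exp (-B x) * F x - Γ x)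
      (Real.exp (-B x) * (-b x) * F x + Real.exp (-B x) * F' x - γ x) x := fun x hx =>
    (((hB x hx).neg.exp).mul (hF x hx)).sub (hΓ x hx)
  have hanti : AntitoneOn (fun x => Real.exp (-B x) * F x - Γ x) (Set.Ioc c e) := by
    refine antitoneOn_of_deriv_nonpos (convex_Ioc c e) ((hBc.neg.rexp.mul hFc).sub hΓc) ?_ ?_
    · rw [interior_Ioc]
      exact fun x hx => (hd x hx).differentiableAt.differentiableWithinAt
    · rw [interior_Ioc]
      intro x hx
      rw [(hd x hx).deriv]
      have h1 : Real.exp (-B x) ≤ 1 := Real.exp_le_one_iff.2 (by linarith [hB0 x hx])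
      have h2 := mul_le_mul_of_nonneg_left (hle x hx) (Real.exp_pos (-B x)).le
      have h3 := mul_le_mul_of_nonneg_right h1 (hγ0 x hx)
      nlinarith
  have hlim : Tendsto (fun x => Real.exp (-B x) * F x - Γ x) (𝓝[>] c) (𝓝 F0) := by
    have := ((hBl.neg.rexp).mul hFl).sub hΓl
    simpa using this
  have h1 : Real.exp (-B e) * F e - Γ e ≤ F0 := by
    refine ge_of_tendsto hlim ?_
    filter_upwards [Ioo_mem_nhdsGT hce] with x hx
    exact hanti ⟨hx.1, hx.2.le⟩ ⟨hce, le_rfl⟩ hx.2.le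
  calc F e = Real.exp (B e) * (Real.exp (-B e) * F e) := by
        rw [← mul_assoc, ← Real.exp_add]; simp
    _ ≤ _ := by gcongr; linarith

lemma exists_tendsto_of_integrableOn_deriv {f f' : ℝ → ℂ} {δ : ℝ} (hδ : 0 < δ)
    (hf : ∀ x ∈ Set.Ioo 0 δ, HasDerivAt f (f' x) x) (hi : IntegrableOn f' (Set.Ioo 0 δ)) :
    ∃ L, Tendsto f (𝓝[>] 0) (𝓝 L) := by
  have hx0 : 0 < δ / 2 := by positivity
  have hIcc : IntegrableOn f' (Set.uIcc 0 (δ / 2)) := by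
    rw [Set.uIcc_of_le hx0.le, integrableOn_Icc_iff_integrableOn_Ioc]
    exact hi.mono_set fun x hx => ⟨hx.1, by linarith [hx.2]⟩
  have hc := intervalIntegral.continuousOn_primitive_interval_left hIcc
  have h1 : Tendsto (fun x => ∫ t in x..(δ / 2), f' t) (𝓝[>] 0)
      (𝓝 (∫ t in (0 : ℝ)..(δ / 2), f' t)) := by
    have h2 := hc 0 (by rw [Set.uIcc_of_le hx0.le]; exact ⟨le_rfl, hx0.le⟩)
    refine h2.tendsto.mono_left ?_
    rw [Set.uIcc_of_le hx0.le, ← nhdsWithin_Ioc_eq_nhdsGT hx0]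
    exact nhdsWithin_mono _ Set.Ioc_subset_Icc_self
  refine ⟨f (δ / 2) - ∫ t in (0 : ℝ)..(δ / 2), f' t, (h1.const_sub (f (δ / 2))).congr' ?_⟩
  filter_upwards [Ioo_mem_nhdsGT hx0] with x hx
  rw [intervalIntegral.integral_eq_sub_of_hasDerivAt_of_le hx.2.le]
  · ring
  · intro y hy
    exact (hf y ⟨hx.1.trans_le hy.1, by linarith [hy.2]⟩).continuousAt.continuousWithinAt
  · exact fun y hy => hf y ⟨hx.1.trans hy.1, by linarith [hy.2]⟩
  · rw [intervalIntegrable_iff_integrableOn_Ioc_of_le hx.2.le]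
    exact hi.mono_set fun y hy => ⟨hx.1.trans hy.1, by linarith [hy.2]⟩

lemma eq_zero_of_tendsto_cpow_mul_sub {ν L₁ L₂ : ℂ} (hν : ν.re = 0) (hν0 : ν ≠ 0)
    (h : Tendsto (fun x : ℝ => (x : ℂ) ^ (2 * ν) * L₁ - L₂) (𝓝[>] 0) (𝓝 0)) :
    L₁ = 0 ∧ L₂ = 0 := by
  have hb : ν.im ≠ 0 := fun h => hν0 (Complex.ext hν h)
  have hνe : ν = ν.im * Complex.I := by
    apply Complex.ext <;> simp [hν]
  have hseq : ∀ θ : ℝ, Tendsto (fun n : ℕ => Real.exp (-((Real.pi / |ν.im|) * n + θ)))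
      atTop (𝓝[>] 0) := by
    intro θ
    refine tendsto_nhdsWithin_iff.2 ⟨?_, Eventually.of_forall fun n => Real.exp_pos _⟩
    refine Real.tendsto_exp_neg_atTop_nhds_zero.comp (tendsto_atTop_add_const_right _ _ ?_)
    exact tendsto_natCast_atTop_atTop.const_mul_atTop
      (div_pos Real.pi_pos (abs_pos.2 hb))
  have hval : ∀ (θ : ℝ) (n : ℕ), ((Real.exp (-((Real.pi / |ν.im|) * n + θ)) : ℝ) : ℂ) ^ (2 * ν)
      = Complex.exp (-(2 * ν * θ)) := by
    intro θ n
    rw [Complex.cpow_def_of_ne_zero (by exact_mod_cast (Real.exp_pos _).ne'),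
      ← Complex.ofReal_log (Real.exp_pos _).le, Real.log_exp]
    rcases abs_choice ν.im with h | h
    · have : ((-((Real.pi / |ν.im|) * n + θ) : ℝ) : ℂ) * (2 * ν) =
          -(2 * ν * θ) - (n : ℂ) * (2 * Real.pi * Complex.I) := by
        rw [h]
        have hb' : (ν.im : ℂ) ≠ 0 := by exact_mod_cast hb
        rw [hνe]
        push_cast
        simp
        field_simp
        ring
      rw [this, Complex.exp_sub, Complex.exp_nat_mul_two_pi_mul_I, div_one]
    · have : ((-((Real.pi / |ν.im|) * n + θ) : ℝ) : ℂ) * (2 * ν) =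
          -(2 * ν * θ) + (n : ℂ) * (2 * Real.pi * Complex.I) := by
        rw [h]
        have hb' : (ν.im : ℂ) ≠ 0 := by exact_mod_cast hb
        rw [hνe]
        push_cast
        simp
        field_simp
      rw [this, Complex.exp_add, Complex.exp_nat_mul_two_pi_mul_I, mul_one]
  have hlim : ∀ θ : ℝ, Complex.exp (-(2 * ν * θ)) * L₁ - L₂ = 0 := by
    intro θ
    have h1 := h.comp (hseq θ)
    simp only [Function.comp_def, hval] at h1
    exact tendsto_nhds_unique tendsto_const_nhds h1
  have h1 := hlim 0
  have h2 := hlim (Real.pi / (2 * ν.im))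
  have he : Complex.exp (-(2 * ν * (Real.pi / (2 * ν.im) : ℝ))) = -1 := by
    have : -(2 * ν * (Real.pi / (2 * ν.im) : ℝ)) = -(Real.pi * Complex.I) := by
      have hb' : (ν.im : ℂ) ≠ 0 := by exact_mod_cast hb
      rw [hνe]
      push_cast
      simp
      field_simp
    rw [this, Complex.exp_neg, Complex.exp_pi_mul_I]
    norm_num
  rw [he] at h2
  simp at h1
  constructor
  · linear_combination (1/2) * h1 - (1/2) * h2
  · linear_combination -(1/2) * h1 - (1/2) * h2

/-- The coefficient of `x^(1/2+ν)` (times `2ν`) in a solution `D`, with derivative `D₁`, of a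
perturbation of `D'' = (ν²-1/4)/x² D`. -/
noncomputable def eulerCoeff (ν : ℂ) (D D₁ : ℝ → ℂ) (x : ℝ) : ℂ :=
  (x : ℂ) ^ (-ν - 1/2) * (x * D₁ x + (ν - 1/2) * D x)

lemma hasDerivAt_ofReal_cpow_of_pos (b : ℂ) {x : ℝ} (hx : 0 < x) :
    HasDerivAt (fun y : ℝ => (y : ℂ) ^ b) (b * (x : ℂ) ^ (b - 1)) x := by
  simpa using ((hasDerivAt_id (x : ℂ)).cpow_const (c := b)
    (Complex.ofReal_mem_slitPlane.2 hx)).comp_ofReal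

lemma hasDerivAt_eulerCoeff {ν : ℂ} {D D₁ : ℝ → ℂ} {R : ℂ} {x : ℝ} (hx : 0 < x)
    (hD : HasDerivAt D (D₁ x) x) (hD₁ : HasDerivAt D₁ ((ν ^ 2 - 1/4) / x ^ 2 * D x + R) x) :
    HasDerivAt (eulerCoeff ν D D₁) ((x : ℂ) ^ (1/2 - ν) * R) x := by
  have hx0 : (x : ℂ) ≠ 0 := by exact_mod_cast hx.ne'
  have h1 := hasDerivAt_ofReal_cpow_of_pos (-ν - 1/2) hx
  have h2 : HasDerivAt (fun y : ℝ => (y : ℂ)) 1 x := by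
    simpa using (hasDerivAt_id (x : ℂ)).comp_ofReal
  refine (h1.mul ((h2.mul hD₁).add (hD.const_mul (ν - 1/2)))).congr_deriv ?_
  have e1 : (x : ℂ) ^ (-ν - 1/2) = (x : ℂ) ^ (-ν - 1/2 - 1) * x := by
    rw [Complex.cpow_sub _ 1 hx0, Complex.cpow_one]; field_simp
  have e2 : (x : ℂ) ^ (1/2 - ν) = (x : ℂ) ^ (-ν - 1/2 - 1) * x ^ 2 := by
    have : (1/2 - ν) = (-ν - 1/2 - 1) + (2 : ℕ) := by push_cast; ring
    rw [this, Complex.cpow_add _ _ hx0, Complex.cpow_natCast]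
  simp only [Pi.add_apply, Pi.mul_apply, e1, e2]
  field_simp
  ring

lemma eulerCoeff_sub {ν : ℂ} {D D₁ : ℝ → ℂ} {x : ℝ} (hx : 0 < x) :
    (x : ℂ) ^ (1/2 + ν) * eulerCoeff ν D D₁ x - (x : ℂ) ^ (1/2 - ν) * eulerCoeff (-ν) D D₁ x =
      2 * ν * D x := by
  have hx0 : (x : ℂ) ≠ 0 := by exact_mod_cast hx.ne'
  have e1 : (x : ℂ) ^ (1/2 + ν) * (x : ℂ) ^ (-ν - 1/2) = 1 := by
    rw [← Complex.cpow_add _ _ hx0]; ring_nf; simp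
  have e2 : (x : ℂ) ^ (1/2 - ν) * (x : ℂ) ^ (-(-ν) - 1/2) = 1 := by
    rw [← Complex.cpow_add _ _ hx0]; ring_nf; simp
  simp only [eulerCoeff]
  linear_combination (x * D₁ x + (ν - 1/2) * D x) * e1 - (x * D₁ x + (-ν - 1/2) * D x) * e2

lemma eulerCoeff_add {ν : ℂ} {D D₁ : ℝ → ℂ} {x : ℝ} (hx : 0 < x) :
    (x : ℂ) ^ (1/2 + ν) * eulerCoeff ν D D₁ x + (x : ℂ) ^ (1/2 - ν) * eulerCoeff (-ν) D D₁ x =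
      2 * x * D₁ x - D x := by
  have hx0 : (x : ℂ) ≠ 0 := by exact_mod_cast hx.ne'
  have e1 : (x : ℂ) ^ (1/2 + ν) * (x : ℂ) ^ (-ν - 1/2) = 1 := by
    rw [← Complex.cpow_add _ _ hx0]; ring_nf; simp
  have e2 : (x : ℂ) ^ (1/2 - ν) * (x : ℂ) ^ (-(-ν) - 1/2) = 1 := by
    rw [← Complex.cpow_add _ _ hx0]; ring_nf; simp
  simp only [eulerCoeff]
  linear_combination (x * D₁ x + (ν - 1/2) * D x) * e1 + (x * D₁ x + (-ν - 1/2) * D x) * e2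

lemma norm_cpow_half_add {ν : ℂ} (hν : ν.re = 0) {x : ℝ} (hx : 0 < x) :
    ‖(x : ℂ) ^ (1/2 + ν)‖ = √x := by
  rw [Complex.norm_cpow_eq_rpow_re_of_pos hx, Real.sqrt_eq_rpow]
  simp [hν]

lemma norm_cpow_half_sub {ν : ℂ} (hν : ν.re = 0) {x : ℝ} (hx : 0 < x) :
    ‖(x : ℂ) ^ (1/2 - ν)‖ = √x := by
  rw [sub_eq_add_neg]
  exact norm_cpow_half_add (by simp [hν]) hx

lemma norm_le_eulerCoeff {ν : ℂ} (hν : ν.re = 0) {D D₁ : ℝ → ℂ} {x : ℝ} (hx : 0 < x) :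
    2 * ‖ν‖ * ‖D x‖ ≤ √x * (‖eulerCoeff ν D D₁ x‖ + ‖eulerCoeff (-ν) D D₁ x‖) := by
  have h := congrArg norm (eulerCoeff_sub (ν := ν) (D := D) (D₁ := D₁) hx)
  rw [norm_mul, norm_mul, Complex.norm_ofNat] at h
  rw [← h]
  refine (norm_sub_le _ _).trans ?_
  rw [norm_mul, norm_mul, norm_cpow_half_add hν hx, norm_cpow_half_sub hν hx]
  linarith

lemma norm_deriv_le_eulerCoeff {ν : ℂ} (hν : ν.re = 0) {D D₁ : ℝ → ℂ} {x : ℝ} (hx : 0 < x) :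
    2 * x * ‖D₁ x‖ ≤ ‖D x‖ + √x * (‖eulerCoeff ν D D₁ x‖ + ‖eulerCoeff (-ν) D D₁ x‖) := by
  have h := eulerCoeff_add (ν := ν) (D := D) (D₁ := D₁) hx
  have h2 : 2 * x * ‖D₁ x‖ = ‖2 * (x : ℂ) * D₁ x‖ := by
    rw [norm_mul, norm_mul, Complex.norm_ofNat, Complex.norm_real, Real.norm_eq_abs, abs_of_pos hx]
  have h3 : 2 * (x : ℂ) * D₁ x = D x + ((x : ℂ) ^ (1/2 + ν) * eulerCoeff ν D D₁ x +
      (x : ℂ) ^ (1/2 - ν) * eulerCoeff (-ν) D D₁ x) := by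
    rw [h]; ring
  rw [h2, h3]
  refine (norm_add_le _ _).trans ?_
  gcongr
  refine (norm_add_le _ _).trans ?_
  rw [norm_mul, norm_mul, norm_cpow_half_add hν hx, norm_cpow_half_sub hν hx]
  linarith

lemma eulerCoeff_tendsto_zero {ν : ℂ} (hν : ν.re = 0) (hν0 : ν ≠ 0) {D D₁ R : ℝ → ℂ} {δ : ℝ}
    (hδ : 0 < δ) (hD : ∀ x ∈ Set.Ioo 0 δ, HasDerivAt D (D₁ x) x)
    (hD₁ : ∀ x ∈ Set.Ioo 0 δ, HasDerivAt D₁ ((ν ^ 2 - 1/4) / x ^ 2 * D x + R x) x)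
    (hRc : ContinuousOn R (Set.Ioo 0 δ))
    (hRi : IntegrableOn (fun x => √x * ‖R x‖) (Set.Ioo 0 δ))
    (hlim : Tendsto (fun x : ℝ => (x : ℂ) ^ (-1/2 - ν) * D x) (𝓝[>] 0) (𝓝 0)) :
    Tendsto (eulerCoeff ν D D₁) (𝓝[>] 0) (𝓝 0) ∧
      Tendsto (eulerCoeff (-ν) D D₁) (𝓝[>] 0) (𝓝 0) := by
  have hcpow : ∀ η : ℂ, η.re = 0 →
      IntegrableOn (fun x : ℝ => (x : ℂ) ^ (1/2 - η) * R x) (Set.Ioo 0 δ) := by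
    intro η hη
    refine Integrable.mono hRi (ContinuousOn.aestronglyMeasurable (fun x hx => ?_)
      measurableSet_Ioo) ?_
    · exact ((hasDerivAt_ofReal_cpow_of_pos (1/2 - η) hx.1).continuousAt.continuousWithinAt).mul
        (hRc x hx)
    · filter_upwards [ae_restrict_mem measurableSet_Ioo] with x hx
      rw [norm_mul, norm_cpow_half_sub hη hx.1, Real.norm_eq_abs, abs_of_nonneg (by positivity)]
  obtain ⟨L₁, hL₁⟩ := exists_tendsto_of_integrableOn_deriv hδ
    (fun x hx => hasDerivAt_eulerCoeff hx.1 (hD x hx) (hD₁ x hx)) (hcpow ν hν)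
  obtain ⟨L₂, hL₂⟩ := exists_tendsto_of_integrableOn_deriv hδ
    (fun x hx => hasDerivAt_eulerCoeff (ν := -ν) hx.1 (hD x hx)
      (by simpa only [neg_sq] using hD₁ x hx)) (hcpow (-ν) (by simp [hν]))
  suffices h : L₁ = 0 ∧ L₂ = 0 by
    rw [h.1] at hL₁
    rw [h.2] at hL₂
    exact ⟨hL₁, hL₂⟩
  refine eq_zero_of_tendsto_cpow_mul_sub hν hν0 ?_
  have hbd : ∀ᶠ x : ℝ in 𝓝[>] 0, ‖(x : ℂ) ^ (2 * ν)‖ ≤ 1 := by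
    filter_upwards [self_mem_nhdsWithin] with x hx
    rw [Complex.norm_cpow_eq_rpow_re_of_pos hx]
    simp [hν]
  have h1 : Tendsto (fun x : ℝ => (x : ℂ) ^ (2 * ν) * (L₁ - eulerCoeff ν D D₁ x))
      (𝓝[>] 0) (𝓝 0) := by
    have h0 : Tendsto (fun x => L₁ - eulerCoeff ν D D₁ x) (𝓝[>] 0) (𝓝 0) := by
      simpa using hL₁.const_sub L₁
    refine squeeze_zero_norm' ?_ (tendsto_zero_iff_norm_tendsto_zero.1 h0)
    filter_upwards [hbd] with x hx
    rw [norm_mul]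
    exact mul_le_of_le_one_left (norm_nonneg _) hx
  have h2 : Tendsto (fun x : ℝ => (x : ℂ) ^ (2 * ν) * (2 * ν * ((x : ℂ) ^ (-1/2 - ν) * D x)))
      (𝓝[>] 0) (𝓝 0) := by
    have h0 : Tendsto (fun x : ℝ => 2 * ν * ((x : ℂ) ^ (-1/2 - ν) * D x)) (𝓝[>] 0) (𝓝 0) := by
      simpa using hlim.const_mul (2 * ν)
    refine squeeze_zero_norm' ?_ (tendsto_zero_iff_norm_tendsto_zero.1 h0)
    filter_upwards [hbd] with x hx
    rw [norm_mul]
    exact mul_le_of_le_one_left (norm_nonneg _) hx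
  have h3 := (h1.add h2).add (hL₂.sub_const L₂)
  simp only [sub_self, add_zero] at h3
  refine h3.congr' ?_
  filter_upwards [self_mem_nhdsWithin] with x hx
  have hx' : (0 : ℝ) < x := hx
  have hx0 : (x : ℂ) ≠ 0 := by exact_mod_cast hx'.ne'
  have h := eulerCoeff_sub (ν := ν) (D := D) (D₁ := D₁) hx'
  have e1 : (x : ℂ) ^ (-1/2 - ν) * (x : ℂ) ^ (1/2 + ν) = 1 := by
    rw [← Complex.cpow_add _ _ hx0]; ring_nf; simp
  have e2 : (x : ℂ) ^ (2 * ν) * ((x : ℂ) ^ (-1/2 - ν) * (x : ℂ) ^ (1/2 - ν)) = 1 := by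
    rw [← Complex.cpow_add _ _ hx0, ← Complex.cpow_add _ _ hx0]; ring_nf; simp
  linear_combination -(x : ℂ) ^ (2 * ν) * (x : ℂ) ^ (-1/2 - ν) * h +
    (x : ℂ) ^ (2 * ν) * eulerCoeff ν D D₁ x * e1 - eulerCoeff (-ν) D D₁ x * e2

lemma hasDerivAt_norm_sq_le {f : ℝ → ℂ} {f' : ℂ} {x : ℝ} (hf : HasDerivAt f f' x) :
    ∃ d, HasDerivAt (fun y => ‖f y‖ ^ 2) d x ∧ d ≤ 2 * (‖f x‖ * ‖f'‖) :=
  ⟨_, hf.norm_sq, by gcongr; exact real_inner_le_norm _ _⟩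

lemma eulerCoeff_energy_le {ν : ℂ} (hν : ν.re = 0) (hν0 : ν ≠ 0) {C μ ε x₀ : ℝ}
    (hμ : 0 < μ) (hx₀ : x₀ = 1 / μ) (hε : 0 < ε) (hε1 : ε ≤ 1)
    {q₀ D D₁ φ : ℝ → ℂ} {W : ℝ → ℝ}
    (hD : ∀ x ∈ Set.Ioc 0 x₀, HasDerivAt D (D₁ x) x)
    (hD₁ : ∀ x ∈ Set.Ioc 0 x₀, HasDerivAt D₁
      ((ν ^ 2 - 1/4) / x ^ 2 * D x + (μ ^ 2 * D x + q₀ x * (D x + φ x))) x)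
    (hW : ∀ x ∈ Set.Ioo 0 x₀, HasDerivAt W (x * ‖q₀ x‖) x)
    (hWc : ContinuousOn W (Set.Ioc 0 x₀)) (hW0 : Tendsto W (𝓝[>] 0) (𝓝 0))
    (hWn : ∀ x ∈ Set.Ioc 0 x₀, 0 ≤ W x) (hWε : W x₀ ≤ ε)
    (hφ : ∀ x ∈ Set.Ioc 0 x₀, ‖φ x‖ ≤ C * √x)
    (hP : Tendsto (eulerCoeff ν D D₁) (𝓝[>] 0) (𝓝 0))
    (hM : Tendsto (eulerCoeff (-ν) D D₁) (𝓝[>] 0) (𝓝 0)) :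
    ‖eulerCoeff ν D D₁ x₀‖ ^ 2 + ‖eulerCoeff (-ν) D D₁ x₀‖ ^ 2 ≤
      Real.exp (3 / ‖ν‖ + 1) * (2 * C ^ 2) * ε ^ 2 := by
  have hN : 0 < ‖ν‖ := norm_pos_iff.2 hν0
  have hx₀p : 0 < x₀ := by rw [hx₀]; positivity
  have hPd : ∀ x ∈ Set.Ioc 0 x₀, HasDerivAt (eulerCoeff ν D D₁)
      ((x : ℂ) ^ (1/2 - ν) * (μ ^ 2 * D x + q₀ x * (D x + φ x))) x := fun x hx =>
    hasDerivAt_eulerCoeff hx.1 (hD x hx) (hD₁ x hx)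
  have hMd : ∀ x ∈ Set.Ioc 0 x₀, HasDerivAt (eulerCoeff (-ν) D D₁)
      ((x : ℂ) ^ (1/2 - -ν) * (μ ^ 2 * D x + q₀ x * (D x + φ x))) x := fun x hx =>
    hasDerivAt_eulerCoeff hx.1 (hD x hx) (by simpa only [neg_sq] using hD₁ x hx)
  set P := eulerCoeff ν D D₁ with hPdef
  set M := eulerCoeff (-ν) D D₁ with hMdef
  have hF : ∀ x ∈ Set.Ioc 0 x₀, ∃ d, HasDerivAt (fun y => ‖P y‖ ^ 2 + ‖M y‖ ^ 2) d x ∧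
      d ≤ (2 * μ ^ 2 * x / ‖ν‖ + (2 / ‖ν‖ + 1 / ε) * (x * ‖q₀ x‖)) * (‖P x‖ ^ 2 + ‖M x‖ ^ 2) +
        2 * C ^ 2 * ε * (x * ‖q₀ x‖) := by
    intro x hx
    obtain ⟨d₁, hd₁, hd₁'⟩ := hasDerivAt_norm_sq_le (hPd x hx)
    obtain ⟨d₂, hd₂, hd₂'⟩ := hasDerivAt_norm_sq_le (hMd x hx)
    refine ⟨d₁ + d₂, hd₁.add hd₂, ?_⟩
    rw [norm_mul, norm_cpow_half_sub hν hx.1] at hd₁'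
    rw [norm_mul, norm_cpow_half_sub (by simp [hν]) hx.1] at hd₂'
    have hDle := norm_le_eulerCoeff hν (D := D) (D₁ := D₁) hx.1
    rw [← hPdef, ← hMdef] at hDle
    have hφx := hφ x hx
    have hR : ‖(μ : ℂ) ^ 2 * D x + q₀ x * (D x + φ x)‖ ≤
        (μ ^ 2 + ‖q₀ x‖) * ‖D x‖ + ‖q₀ x‖ * (C * √x) := by
      refine (norm_add_le _ _).trans ?_
      rw [norm_mul, norm_mul, norm_pow, Complex.norm_real, Real.norm_eq_abs, sq_abs]
      have h1 : ‖q₀ x‖ * ‖D x + φ x‖ ≤ ‖q₀ x‖ * (‖D x‖ + C * √x) := by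
        gcongr
        exact (norm_add_le _ _).trans (by gcongr)
      linarith
    set r := ‖(μ : ℂ) ^ 2 * D x + q₀ x * (D x + φ x)‖
    set p := ‖P x‖
    set m := ‖M x‖
    set Q := ‖q₀ x‖
    have hp : 0 ≤ p := norm_nonneg _
    have hm : 0 ≤ m := norm_nonneg _
    have hQ : 0 ≤ Q := norm_nonneg _
    have hs : 0 ≤ √x := Real.sqrt_nonneg _
    have hss : √x * √x = x := Real.mul_self_sqrt hx.1.le
    have hDle' : ‖D x‖ ≤ √x * (p + m) / (2 * ‖ν‖) := by
      rw [le_div_iff₀ (by positivity)]; linarith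
    have hxp : 0 < x := hx.1
    calc d₁ + d₂ ≤ 2 * (p + m) * √x * r := by linarith
      _ ≤ 2 * (p + m) * √x * ((μ ^ 2 + Q) * (√x * (p + m) / (2 * ‖ν‖)) + Q * (C * √x)) := by
          gcongr
          refine hR.trans ?_
          gcongr
      _ = (√x * √x) * ((μ ^ 2 + Q) / ‖ν‖) * (p + m) ^ 2 + (√x * √x) * Q * (2 * C * (p + m)) := by
          field_simp
      _ = x * ((μ ^ 2 + Q) / ‖ν‖) * (p + m) ^ 2 + x * Q * (2 * C * (p + m)) := by rw [hss]
      _ ≤ x * ((μ ^ 2 + Q) / ‖ν‖) * (2 * (p ^ 2 + m ^ 2)) +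
          x * Q * ((p ^ 2 + m ^ 2) / ε + 2 * C ^ 2 * ε) := by
          have h1 : (p + m) ^ 2 ≤ 2 * (p ^ 2 + m ^ 2) := by nlinarith [sq_nonneg (p - m)]
          have h2 : 2 * C * (p + m) ≤ (p ^ 2 + m ^ 2) / ε + 2 * C ^ 2 * ε := by
            rw [div_add' _ _ _ hε.ne', le_div_iff₀ hε]
            nlinarith [sq_nonneg (p + m - 2 * (C * ε)), sq_nonneg (p - m)]
          gcongr
      _ = _ := by
          field_simp
          ring
  choose! F' hF' hFle using hF
  have hBd : ∀ x ∈ Set.Ioo 0 x₀, HasDerivAt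
      (fun x => μ ^ 2 * x ^ 2 / ‖ν‖ + (2 / ‖ν‖ + 1 / ε) * W x)
      (2 * μ ^ 2 * x / ‖ν‖ + (2 / ‖ν‖ + 1 / ε) * (x * ‖q₀ x‖)) x := by
    intro x hx
    refine ((((hasDerivAt_pow 2 x).const_mul (μ ^ 2)).div_const ‖ν‖).add
      ((hW x hx).const_mul (2 / ‖ν‖ + 1 / ε))).congr_deriv ?_
    simp
    ring
  have hmain := le_exp_mul_of_deriv_le (F := fun y => ‖P y‖ ^ 2 + ‖M y‖ ^ 2)
    (B := fun x => μ ^ 2 * x ^ 2 / ‖ν‖ + (2 / ‖ν‖ + 1 / ε) * W x)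
    (Γ := fun x => 2 * C ^ 2 * ε * W x) (F' := F')
    (b := fun x => 2 * μ ^ 2 * x / ‖ν‖ + (2 / ‖ν‖ + 1 / ε) * (x * ‖q₀ x‖))
    (γ := fun x => 2 * C ^ 2 * ε * (x * ‖q₀ x‖)) (F0 := 0) hx₀p
    (fun x hx => (hF' x hx).continuousAt.continuousWithinAt)
    ((by fun_prop : Continuous fun x : ℝ => μ ^ 2 * x ^ 2 / ‖ν‖).continuousOn.add
      (hWc.const_mul _))
    (hWc.const_mul _) (fun x hx => hF' x ⟨hx.1, hx.2.le⟩) hBd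
    (fun x hx => (hW x hx).const_mul _) (fun x hx => hFle x ⟨hx.1, hx.2.le⟩)
    (fun x hx => by
      have := hWn x ⟨hx.1, hx.2.le⟩
      positivity)
    (fun x hx => by
      have := hx.1
      positivity)
    (by simpa using (hP.norm.pow 2).add (hM.norm.pow 2))
    (by
      have h1 : Tendsto (fun x : ℝ => μ ^ 2 * x ^ 2 / ‖ν‖) (𝓝[>] 0) (𝓝 0) := by
        have : ContinuousAt (fun x : ℝ => μ ^ 2 * x ^ 2 / ‖ν‖) 0 := by fun_prop
        have h2 := this.tendsto.mono_left (nhdsWithin_le_nhds (s := Set.Ioi 0))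
        simpa using h2
      simpa using h1.add (hW0.const_mul (2 / ‖ν‖ + 1 / ε)))
    (by simpa using hW0.const_mul (2 * C ^ 2 * ε))
  refine hmain.trans ?_
  have hWx := hWn x₀ ⟨hx₀p, le_rfl⟩
  have hB : μ ^ 2 * x₀ ^ 2 / ‖ν‖ + (2 / ‖ν‖ + 1 / ε) * W x₀ ≤ 3 / ‖ν‖ + 1 := by
    have e1 : μ ^ 2 * x₀ ^ 2 = 1 := by rw [hx₀]; field_simp
    have e2 : (2 / ‖ν‖ + 1 / ε) * W x₀ ≤ (2 / ‖ν‖ + 1 / ε) * ε := by gcongr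
    have e3 : (2 / ‖ν‖ + 1 / ε) * ε = 2 / ‖ν‖ * ε + 1 := by field_simp
    have e4 : 2 / ‖ν‖ * ε ≤ 2 / ‖ν‖ * 1 := by gcongr
    have e5 : 3 / ‖ν‖ = 1 / ‖ν‖ + 2 / ‖ν‖ := by ring
    rw [e1, e5]
    linarith
  calc _ ≤ Real.exp (3 / ‖ν‖ + 1) * (0 + 2 * C ^ 2 * ε * ε) := by
        gcongr
    _ = _ := by ring

set_option maxHeartbeats 800000 in
lemma energy_le_of_one_div_le {ν : ℂ} {C K μ ε x₀ a : ℝ}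
    (hμ : 0 < μ) (hx₀ : x₀ = 1 / μ) (hxa : x₀ < a) (hε : 0 < ε) (hε1 : ε ≤ 1)
    {q₀ D D₁ φ : ℝ → ℂ} {W : ℝ → ℝ}
    (hD : ∀ x ∈ Set.Ioc 0 a, HasDerivAt D (D₁ x) x)
    (hD₁ : ∀ x ∈ Set.Ioc 0 a, HasDerivAt D₁
      ((ν ^ 2 - 1/4) / x ^ 2 * D x + (μ ^ 2 * D x + q₀ x * (D x + φ x))) x)
    (hW : ∀ x ∈ Set.Ioo x₀ a, HasDerivAt W (‖q₀ x‖ / μ) x)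
    (hWc : ContinuousOn W (Set.Icc x₀ a))
    (hWn : ∀ x ∈ Set.Icc x₀ a, W x₀ ≤ W x) (hW0 : 0 ≤ W x₀) (hWε : W a ≤ ε)
    (hφ : ∀ x ∈ Set.Icc x₀ a, ‖φ x‖ ≤ C * (μ ^ (-1/2 : ℝ) * Real.exp (μ * x)))
    (hK : ‖D₁ x₀‖ ^ 2 + μ ^ 2 * ‖D x₀‖ ^ 2 ≤ μ * K * ε ^ 2) :
    ‖D₁ a‖ ^ 2 + μ ^ 2 * ‖D a‖ ^ 2 ≤
      Real.exp (‖ν ^ 2 - 1/4‖ + 2) * (K + C ^ 2) * ε ^ 2 * μ * Real.exp (2 * (μ * a)) := by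
  have hx₀p : 0 < x₀ := by rw [hx₀]; positivity
  set κ := ‖ν ^ 2 - 1/4‖ with hκ
  have hF : ∀ x ∈ Set.Icc x₀ a, ∃ d, HasDerivAt
      (fun y => Real.exp (-(2 * (μ * y))) * (‖D₁ y‖ ^ 2 + μ ^ 2 * ‖D y‖ ^ 2)) d x ∧
      d ≤ (κ / (μ * x ^ 2) + (1 + 1 / ε) * (‖q₀ x‖ / μ)) *
        (Real.exp (-(2 * (μ * x))) * (‖D₁ x‖ ^ 2 + μ ^ 2 * ‖D x‖ ^ 2)) +
        C ^ 2 * ε * μ * (‖q₀ x‖ / μ) := by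
    intro x hx
    have hxp : 0 < x := hx₀p.trans_le hx.1
    have hx' : x ∈ Set.Ioc 0 a := ⟨hxp, hx.2⟩
    obtain ⟨d₁, hd₁, hd₁'⟩ := hasDerivAt_norm_sq_le (hD₁ x hx')
    obtain ⟨d₂, hd₂, hd₂'⟩ := hasDerivAt_norm_sq_le (hD x hx')
    have he : HasDerivAt (fun y : ℝ => Real.exp (-(2 * (μ * y))))
        (Real.exp (-(2 * (μ * x))) * (-(2 * μ))) x := by
      simpa using ((((hasDerivAt_id x).const_mul μ).const_mul 2).neg).exp
    refine ⟨_, he.mul (hd₁.add (hd₂.const_mul (μ ^ 2))), ?_⟩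
    have hR : ‖(ν ^ 2 - 1/4) / (x : ℂ) ^ 2 * D x + (μ ^ 2 * D x + q₀ x * (D x + φ x))‖ ≤
        (κ / x ^ 2 + μ ^ 2 + ‖q₀ x‖) * ‖D x‖ + ‖q₀ x‖ * ‖φ x‖ := by
      refine (norm_add_le _ _).trans ?_
      have h1 : ‖(ν ^ 2 - 1/4) / (x : ℂ) ^ 2 * D x‖ = κ / x ^ 2 * ‖D x‖ := by
        rw [norm_mul, norm_div, norm_pow, Complex.norm_real, Real.norm_eq_abs, sq_abs]
      have h2 : ‖(μ : ℂ) ^ 2 * D x + q₀ x * (D x + φ x)‖ ≤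
          μ ^ 2 * ‖D x‖ + ‖q₀ x‖ * (‖D x‖ + ‖φ x‖) := by
        refine (norm_add_le _ _).trans ?_
        rw [norm_mul, norm_mul, norm_pow, Complex.norm_real, Real.norm_eq_abs, sq_abs]
        gcongr
        exact norm_add_le _ _
      rw [h1]
      linarith
    have hφx := hφ x hx
    set E := Real.exp (-(2 * (μ * x))) with hE
    set e := Real.exp (μ * x) with he'
    have hEe : E * (e * e) = 1 := by
      rw [hE, he', ← Real.exp_add, ← Real.exp_add]; ring_nf; simp
    set h := μ ^ (-1/2 : ℝ) with hh
    have hhh : h * h * μ = 1 := by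
      rw [hh, ← Real.rpow_add hμ]; norm_num
      rw [Real.rpow_neg_one]; field_simp
    set r := ‖(ν ^ 2 - 1/4) / (x : ℂ) ^ 2 * D x + (μ ^ 2 * D x + q₀ x * (D x + φ x))‖
    set s := ‖D₁ x‖
    set t := ‖D x‖
    set Q := ‖q₀ x‖
    have hs : 0 ≤ s := norm_nonneg _
    have ht : 0 ≤ t := norm_nonneg _
    have hQ : 0 ≤ Q := norm_nonneg _
    have hκ0 : 0 ≤ κ := norm_nonneg _
    have hE0 : 0 < E := Real.exp_pos _
    have hdd : d₁ + μ ^ 2 * d₂ ≤ (2 * μ ^ 2 + κ / x ^ 2 + Q) * (2 * (s * t)) +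
        Q * (2 * s * (C * (h * e))) := by
      have h1 : d₁ ≤ 2 * (s * ((κ / x ^ 2 + μ ^ 2 + Q) * t + Q * (C * (h * e)))) := by
        refine hd₁'.trans ?_
        gcongr
        refine hR.trans ?_
        gcongr
      have h2 : μ ^ 2 * d₂ ≤ μ ^ 2 * (2 * (t * s)) := by gcongr
      linarith
    have h3 : 2 * (s * t) ≤ (s ^ 2 + μ ^ 2 * t ^ 2) / μ := by
      rw [le_div_iff₀ hμ]
      nlinarith [sq_nonneg (s - μ * t)]
    have h4 : 2 * s * (C * (h * e)) ≤ s ^ 2 / (ε * μ) + C ^ 2 * ε * (e * e) := by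
      rw [div_add' _ _ _ (by positivity), le_div_iff₀ (by positivity)]
      have : (C * ε * e) ^ 2 * (h * h * μ) * μ = C ^ 2 * ε * (e * e) * (ε * μ) := by
        rw [hhh]; ring
      nlinarith [sq_nonneg (s - C * ε * e * h * μ)]
    have h5 : d₁ + μ ^ 2 * d₂ ≤ (2 * μ ^ 2 + κ / x ^ 2 + Q) * ((s ^ 2 + μ ^ 2 * t ^ 2) / μ) +
        Q * ((s ^ 2 + μ ^ 2 * t ^ 2) / (ε * μ) + C ^ 2 * ε * (e * e)) := by
      refine hdd.trans ?_
      gcongr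
      refine h4.trans ?_
      gcongr
      have : 0 ≤ μ ^ 2 * t ^ 2 := by positivity
      linarith
    have h6 := mul_le_mul_of_nonneg_left h5 hE0.le
    calc E * -(2 * μ) * (s ^ 2 + μ ^ 2 * t ^ 2) + E * (d₁ + μ ^ 2 * d₂) ≤
        E * -(2 * μ) * (s ^ 2 + μ ^ 2 * t ^ 2) +
          E * ((2 * μ ^ 2 + κ / x ^ 2 + Q) * ((s ^ 2 + μ ^ 2 * t ^ 2) / μ) +
        Q * ((s ^ 2 + μ ^ 2 * t ^ 2) / (ε * μ) + C ^ 2 * ε * (e * e))) := by linarith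
      _ = (κ / (μ * x ^ 2) + (1 + 1 / ε) * (Q / μ)) * (E * (s ^ 2 + μ ^ 2 * t ^ 2)) +
          C ^ 2 * ε * Q * (E * (e * e)) := by
          field_simp
          ring
      _ = _ := by
          rw [hEe]
          field_simp
  choose! F' hF' hFle using hF
  have hsub : ∀ x ∈ Set.Ioc x₀ a, x ∈ Set.Icc x₀ a := fun x hx => ⟨hx.1.le, hx.2⟩
  have hsub' : ∀ x ∈ Set.Ioo x₀ a, x ∈ Set.Icc x₀ a := fun x hx => ⟨hx.1.le, hx.2.le⟩
  have hBd : ∀ x ∈ Set.Ioo x₀ a, HasDerivAt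
      (fun x => κ * (1 - 1 / (μ * x)) + (1 + 1 / ε) * (W x - W x₀))
      (κ / (μ * x ^ 2) + (1 + 1 / ε) * (‖q₀ x‖ / μ)) x := by
    intro x hx
    have hxp : 0 < x := hx₀p.trans hx.1
    have h1 : HasDerivAt (fun x => 1 / (μ * x)) (-(μ * 1) / (μ * x) ^ 2) x := by
      simpa only [one_div] using
        ((hasDerivAt_id' x).const_mul μ).fun_inv (by positivity : μ * x ≠ 0)
    refine (((h1.const_sub 1).const_mul κ).add
      (((hW x hx).sub_const (W x₀)).const_mul (1 + 1 / ε))).congr_deriv ?_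
    field_simp
  have hμx : μ * x₀ = 1 := by rw [hx₀]; field_simp
  have hgt : 𝓝[>] x₀ ≤ 𝓝[Set.Icc x₀ a] x₀ := by
    rw [← nhdsWithin_Ioc_eq_nhdsGT hxa]
    exact nhdsWithin_mono _ Set.Ioc_subset_Icc_self
  have hWl : Tendsto W (𝓝[>] x₀) (𝓝 (W x₀)) :=
    (hWc x₀ ⟨le_rfl, hxa.le⟩).tendsto.mono_left hgt
  have hWl' : Tendsto (fun x => W x - W x₀) (𝓝[>] x₀) (𝓝 0) := by
    simpa using hWl.sub_const (W x₀)
  have hinvc : ContinuousOn (fun x : ℝ => κ * (1 - 1 / (μ * x))) (Set.Icc x₀ a) := by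
    refine ContinuousOn.mul continuousOn_const (continuousOn_const.sub
      (ContinuousOn.div continuousOn_const (by fun_prop) fun x hx => ?_))
    have : 0 < x := hx₀p.trans_le hx.1
    positivity
  have hmain := le_exp_mul_of_deriv_le
    (F := fun y => Real.exp (-(2 * (μ * y))) * (‖D₁ y‖ ^ 2 + μ ^ 2 * ‖D y‖ ^ 2))
    (B := fun x => κ * (1 - 1 / (μ * x)) + (1 + 1 / ε) * (W x - W x₀))
    (Γ := fun x => C ^ 2 * ε * μ * (W x - W x₀)) (F' := F')
    (b := fun x => κ / (μ * x ^ 2) + (1 + 1 / ε) * (‖q₀ x‖ / μ))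
    (γ := fun x => C ^ 2 * ε * μ * (‖q₀ x‖ / μ)) hxa
    (fun x hx => (hF' x (hsub x hx)).continuousAt.continuousWithinAt)
    ((hinvc.add ((hWc.sub continuousOn_const).const_mul _)).mono Set.Ioc_subset_Icc_self)
    (((hWc.sub continuousOn_const).const_mul _).mono Set.Ioc_subset_Icc_self)
    (fun x hx => hF' x (hsub' x hx)) hBd
    (fun x hx => ((hW x hx).sub_const _).const_mul _) (fun x hx => hFle x (hsub' x hx))
    (fun x hx => by
      have h1 := hWn x (hsub' x hx)
      have h2 : 1 / (μ * x) ≤ 1 := by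
        have : 0 < μ * x := mul_pos hμ (hx₀p.trans hx.1)
        rw [div_le_one this, ← hμx]
        exact mul_le_mul_of_nonneg_left hx.1.le hμ.le
      have h3 : 0 ≤ (1 + 1 / ε) * (W x - W x₀) := mul_nonneg (by positivity) (by linarith)
      have h4 : 0 ≤ κ * (1 - 1 / (μ * x)) := mul_nonneg (norm_nonneg _) (by linarith)
      linarith)
    (fun x hx => by positivity)
    ((hF' x₀ ⟨le_rfl, hxa.le⟩).continuousAt.tendsto.mono_left nhdsWithin_le_nhds)
    (by
      have h1 := (hinvc x₀ ⟨le_rfl, hxa.le⟩).tendsto.mono_left hgt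
      rw [hμx] at h1
      simpa using h1.add (hWl'.const_mul (1 + 1 / ε)))
    (by simpa using hWl'.const_mul (C ^ 2 * ε * μ))
  have hWd : W a - W x₀ ≤ ε := by linarith
  have hWd0 : 0 ≤ W a - W x₀ := by linarith [hWn a ⟨hxa.le, le_rfl⟩]
  have hB : κ * (1 - 1 / (μ * a)) + (1 + 1 / ε) * (W a - W x₀) ≤ κ + 2 := by
    have h1 : (1 + 1 / ε) * (W a - W x₀) ≤ (1 + 1 / ε) * ε := by gcongr
    have h2 : (1 + 1 / ε) * ε = ε + 1 := by field_simp
    have h3 : 0 ≤ κ * (1 / (μ * a)) := by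
      have := hx₀p.trans hxa
      positivity
    linarith
  have hlow : Real.exp (-(2 * (μ * x₀))) * (‖D₁ x₀‖ ^ 2 + μ ^ 2 * ‖D x₀‖ ^ 2) ≤
      μ * K * ε ^ 2 := by
    refine (mul_le_of_le_one_left (by positivity) ?_).trans hK
    rw [hμx]
    exact Real.exp_le_one_iff.2 (by norm_num)
  have hfin : Real.exp (-(2 * (μ * a))) * (‖D₁ a‖ ^ 2 + μ ^ 2 * ‖D a‖ ^ 2) ≤
      Real.exp (κ + 2) * (μ * K * ε ^ 2 + C ^ 2 * ε * μ * ε) := by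
    refine hmain.trans ?_
    gcongr
  have hE : Real.exp (2 * (μ * a)) * Real.exp (-(2 * (μ * a))) = 1 := by
    rw [← Real.exp_add]; simp
  calc ‖D₁ a‖ ^ 2 + μ ^ 2 * ‖D a‖ ^ 2 = Real.exp (2 * (μ * a)) *
        (Real.exp (-(2 * (μ * a))) * (‖D₁ a‖ ^ 2 + μ ^ 2 * ‖D a‖ ^ 2)) := by
        rw [← mul_assoc, hE, one_mul]
    _ ≤ Real.exp (2 * (μ * a)) *
        (Real.exp (κ + 2) * (μ * K * ε ^ 2 + C ^ 2 * ε * μ * ε)) := by gcongr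
    _ = _ := by ring

lemma energy_le_of_eulerCoeff {ν : ℂ} (hν : ν.re = 0) (hν0 : ν ≠ 0) {μ x₀ : ℝ}
    (hμ : 0 < μ) (hx₀ : x₀ = 1 / μ) (D D₁ : ℝ → ℂ) :
    ‖D₁ x₀‖ ^ 2 + μ ^ 2 * ‖D x₀‖ ^ 2 ≤ μ * (1 + 1 / ‖ν‖ ^ 2) *
      (‖eulerCoeff ν D D₁ x₀‖ ^ 2 + ‖eulerCoeff (-ν) D D₁ x₀‖ ^ 2) := by
  have hN : 0 < ‖ν‖ := norm_pos_iff.2 hν0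
  have hx₀p : 0 < x₀ := by rw [hx₀]; positivity
  have h1 := norm_le_eulerCoeff hν (D := D) (D₁ := D₁) hx₀p
  have h2 := norm_deriv_le_eulerCoeff hν (D := D) (D₁ := D₁) hx₀p
  have hs : 0 ≤ √x₀ := Real.sqrt_nonneg _
  have hss : √x₀ * √x₀ = x₀ := Real.mul_self_sqrt hx₀p.le
  have hμx : μ * x₀ = 1 := by rw [hx₀]; field_simp
  set p := ‖eulerCoeff ν D D₁ x₀‖
  set m := ‖eulerCoeff (-ν) D D₁ x₀‖
  set N := ‖ν‖
  set t := ‖D x₀‖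
  set s := ‖D₁ x₀‖
  set y := √x₀
  have hp : 0 ≤ p := norm_nonneg _
  have hm : 0 ≤ m := norm_nonneg _
  have ht : 0 ≤ t := norm_nonneg _
  have hs' : 0 ≤ s := norm_nonneg _
  have hpm : (p + m) ^ 2 ≤ 2 * (p ^ 2 + m ^ 2) := by nlinarith [sq_nonneg (p - m)]
  have hsq : (y * (p + m)) ^ 2 ≤ 2 * x₀ * (p ^ 2 + m ^ 2) := by
    calc (y * (p + m)) ^ 2 = (y * y) * (p + m) ^ 2 := by ring
      _ ≤ x₀ * (2 * (p ^ 2 + m ^ 2)) := by rw [hss]; gcongr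
      _ = _ := by ring
  have h1' : (2 * N * t) ^ 2 ≤ (y * (p + m)) ^ 2 := by gcongr
  have h2' : (2 * x₀ * s) ^ 2 ≤ (t + y * (p + m)) ^ 2 := by gcongr
  have h3 : (t + y * (p + m)) ^ 2 ≤ 2 * t ^ 2 + 2 * (y * (p + m)) ^ 2 := by
    nlinarith [sq_nonneg (t - y * (p + m))]
  have hDt : μ ^ 2 * t ^ 2 ≤ μ * (p ^ 2 + m ^ 2) / (2 * N ^ 2) := by
    rw [le_div_iff₀ (by positivity)]
    calc μ ^ 2 * t ^ 2 * (2 * N ^ 2) = μ ^ 2 * ((2 * N * t) ^ 2 / 2) := by ring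
      _ ≤ μ ^ 2 * (2 * x₀ * (p ^ 2 + m ^ 2) / 2) := by gcongr; linarith
      _ = (μ * x₀) * (μ * (p ^ 2 + m ^ 2)) := by ring
      _ = _ := by rw [hμx, one_mul]
  have hDs : s ^ 2 ≤ μ ^ 2 * t ^ 2 / 2 + μ * (p ^ 2 + m ^ 2) := by
    calc s ^ 2 = (μ * x₀) ^ 2 * s ^ 2 := by rw [hμx]; ring
      _ = μ ^ 2 * ((2 * x₀ * s) ^ 2 / 4) := by ring
      _ ≤ μ ^ 2 * ((2 * t ^ 2 + 2 * (2 * x₀ * (p ^ 2 + m ^ 2))) / 4) := by gcongr; linarith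
      _ = μ ^ 2 * t ^ 2 / 2 + (μ * x₀) * (μ * (p ^ 2 + m ^ 2)) := by ring
      _ = _ := by rw [hμx, one_mul]
  have hnn : 0 ≤ μ * (p ^ 2 + m ^ 2) / N ^ 2 := by positivity
  have e1 : μ * (p ^ 2 + m ^ 2) / (2 * N ^ 2) = (μ * (p ^ 2 + m ^ 2) / N ^ 2) / 2 := by field_simp
  have e2 : μ * (1 + 1 / N ^ 2) * (p ^ 2 + m ^ 2) =
      μ * (p ^ 2 + m ^ 2) + μ * (p ^ 2 + m ^ 2) / N ^ 2 := by field_simp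
  rw [e1] at hDt
  rw [e2]
  linarith

lemma exists_energy_le {ν : ℂ} (hν : ν.re = 0) (hν0 : ν ≠ 0) (C : ℝ) :
    ∃ K : ℝ, 0 ≤ K ∧ ∀ (μ ε a : ℝ) (q₀ D D₁ φ : ℝ → ℂ) (W : ℝ → ℝ),
    0 < μ → 1 / μ < a → 0 < ε → ε ≤ 1 →
    (∀ x ∈ Set.Ioc 0 a, HasDerivAt D (D₁ x) x) →
    (∀ x ∈ Set.Ioc 0 a, HasDerivAt D₁
      ((ν ^ 2 - 1/4) / x ^ 2 * D x + (μ ^ 2 * D x + q₀ x * (D x + φ x))) x) →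
    (∀ x ∈ Set.Ioo 0 a, x ≠ 1 / μ → HasDerivAt W (min x (1 / μ) * ‖q₀ x‖) x) →
    ContinuousOn W (Set.Icc 0 a) → W 0 = 0 → MonotoneOn W (Set.Icc 0 a) → W a ≤ ε →
    (∀ x ∈ Set.Ioc 0 (1 / μ), ‖φ x‖ ≤ C * √x) →
    (∀ x ∈ Set.Icc (1 / μ) a, ‖φ x‖ ≤ C * (μ ^ (-1/2 : ℝ) * Real.exp (μ * x))) →
    Tendsto (eulerCoeff ν D D₁) (𝓝[>] 0) (𝓝 0) →
    Tendsto (eulerCoeff (-ν) D D₁) (𝓝[>] 0) (𝓝 0) →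
    ‖D₁ a‖ ^ 2 + μ ^ 2 * ‖D a‖ ^ 2 ≤ K * ε ^ 2 * μ * Real.exp (2 * (μ * a)) := by
  refine ⟨Real.exp (‖ν ^ 2 - 1/4‖ + 2) *
    ((1 + 1 / ‖ν‖ ^ 2) * (Real.exp (3 / ‖ν‖ + 1) * (2 * C ^ 2)) + C ^ 2), by positivity, ?_⟩
  intro μ ε a q₀ D D₁ φ W hμ hxa hε hε1 hD hD₁ hW hWc hW0 hWm hWε hφ hφ' hP hM
  have hx₀p : 0 < 1 / μ := by positivity
  have ha : 0 < a := hx₀p.trans hxa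
  have h0 : (0 : ℝ) ∈ Set.Icc 0 a := ⟨le_rfl, ha.le⟩
  have hx₀m : 1 / μ ∈ Set.Icc 0 a := ⟨hx₀p.le, hxa.le⟩
  have ham : a ∈ Set.Icc 0 a := ⟨ha.le, le_rfl⟩
  have hWn : ∀ x ∈ Set.Icc 0 a, 0 ≤ W x := fun x hx => hW0 ▸ hWm h0 hx hx.1
  have hlim : Tendsto W (𝓝[>] 0) (𝓝 0) := by
    have h1 : 𝓝[>] (0 : ℝ) ≤ 𝓝[Set.Icc 0 a] 0 := by
      rw [← nhdsWithin_Ioc_eq_nhdsGT ha]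
      exact nhdsWithin_mono _ Set.Ioc_subset_Icc_self
    have h2 := (hWc 0 h0).tendsto.mono_left h1
    rwa [hW0] at h2
  have hE := eulerCoeff_energy_le hν hν0 hμ rfl hε hε1
    (fun x hx => hD x ⟨hx.1, hx.2.trans hxa.le⟩) (fun x hx => hD₁ x ⟨hx.1, hx.2.trans hxa.le⟩)
    (fun x hx => (hW x ⟨hx.1, hx.2.trans hxa⟩ hx.2.ne).congr_deriv (by rw [min_eq_left hx.2.le]))
    (hWc.mono fun x hx => ⟨hx.1.le, hx.2.trans hxa.le⟩) hlim
    (fun x hx => hWn x ⟨hx.1.le, hx.2.trans hxa.le⟩)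
    ((hWm hx₀m ham hxa.le).trans hWε) hφ hP hM
  refine energy_le_of_one_div_le hμ rfl hxa hε hε1 hD hD₁
    (fun x hx => (hW x ⟨hx₀p.trans hx.1, hx.2⟩ hx.1.ne').congr_deriv ?_)
    (hWc.mono fun x hx => ⟨hx₀p.le.trans hx.1, hx.2⟩)
    (fun x hx => hWm hx₀m ⟨hx₀p.le.trans hx.1, hx.2⟩ hx.1) (hWn _ hx₀m) hWε hφ' ?_
  · rw [min_eq_right hx.1.le]; ring
  · calc _ ≤ _ := energy_le_of_eulerCoeff hν hν0 hμ rfl D D₁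
      _ ≤ μ * (1 + 1 / ‖ν‖ ^ 2) * (Real.exp (3 / ‖ν‖ + 1) * (2 * C ^ 2) * ε ^ 2) := by gcongr
      _ = _ := by ring

lemma cpow_neg_half_add_mul (ν : ℂ) {z : ℂ} (hz : z ≠ 0) :
    z ^ (-1/2 + ν) * z = z ^ (1/2 + ν) := by
  have e : (1/2 + ν : ℂ) = -1/2 + ν + 1 := by ring
  rw [e, Complex.cpow_add _ 1 hz, Complex.cpow_one]

/-- The solution of `-u″ + (μ² + (ν² - 1/4) / x²) u = 0` with `u ∼ x ^ (1/2 + ν)` at `0`. -/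
noncomputable def modelSol (ν : ℂ) (μ x : ℝ) : ℂ :=
  (x : ℂ) ^ (1/2 + ν) * (poissonInt ν 0 (μ * x) / poissonInt ν 0 0)

/-- The derivative of `modelSol`. -/
noncomputable def modelDeriv (ν : ℂ) (μ x : ℝ) : ℂ :=
  (x : ℂ) ^ (-1/2 + ν) * (((1/2 + ν) * poissonInt ν 0 (μ * x) +
    (μ * x : ℝ) * poissonInt ν 1 (μ * x)) / poissonInt ν 0 0)

/-- The leading coefficient of `modelSol` at infinity. -/
noncomputable def modelConst (ν : ℂ) : ℂ :=
  Complex.Gamma (1 + ν) * 2 ^ (ν - 1/2) / (√Real.pi : ℝ)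

lemma hasDerivAt_poissonInt_comp {ν : ℂ} (hν : ν.re = 0) (k : ℕ) (μ x : ℝ) :
    HasDerivAt (fun x => poissonInt ν k (μ * x)) (μ * poissonInt ν (k + 1) (μ * x)) x := by
  have h := (hasDerivAt_poissonInt hν k (μ * x)).scomp x ((hasDerivAt_id x).const_mul μ)
  simpa [Function.comp_def] using h

lemma hasDerivAt_modelSol {ν : ℂ} (hν : ν.re = 0) (μ : ℝ) {x : ℝ} (hx : 0 < x) :
    HasDerivAt (modelSol ν μ) (modelDeriv ν μ x) x := by
  have hx' : (x : ℂ) ≠ 0 := by exact_mod_cast hx.ne'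
  have h1 := hasDerivAt_ofReal_cpow_of_pos (1/2 + ν) hx
  have h2 := (hasDerivAt_poissonInt_comp hν 0 μ x).div_const (poissonInt ν 0 0)
  refine (h1.mul h2).congr_deriv ?_
  have e1 : (x : ℂ) ^ (1/2 + ν) = (x : ℂ) ^ (-1/2 + ν) * x := by
    rw [← cpow_neg_half_add_mul ν hx']
  have e2 : (1/2 + ν - 1 : ℂ) = -1/2 + ν := by ring
  rw [modelDeriv, e2, e1]
  push_cast
  ring

lemma hasDerivAt_modelDeriv {ν : ℂ} (hν : ν.re = 0) (μ : ℝ) {x : ℝ} (hx : 0 < x) :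
    HasDerivAt (modelDeriv ν μ)
      ((ν ^ 2 - 1/4) / x ^ 2 * modelSol ν μ x + μ ^ 2 * modelSol ν μ x) x := by
  have hx' : (x : ℂ) ≠ 0 := by exact_mod_cast hx.ne'
  have h1 := hasDerivAt_ofReal_cpow_of_pos (-1/2 + ν) hx
  have h2 := hasDerivAt_poissonInt_comp hν 0 μ x
  have h3 := hasDerivAt_poissonInt_comp hν 1 μ x
  have h4 : HasDerivAt (fun x : ℝ => ((μ * x : ℝ) : ℂ)) μ x := by
    simpa using ((hasDerivAt_id x).const_mul μ).ofReal_comp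
  refine (h1.mul (((h2.const_mul (1/2 + ν)).add (h4.mul h3)).div_const
    (poissonInt ν 0 0))).congr_deriv ?_
  have hode := poissonInt_ode hν (μ * x)
  have e1 : (x : ℂ) ^ (1/2 + ν) = (x : ℂ) ^ (-1/2 + ν) * x := by
    rw [← cpow_neg_half_add_mul ν hx']
  have e2 : (x : ℂ) ^ (-1/2 + ν - 1) = (x : ℂ) ^ (-1/2 + ν) / x := by
    rw [Complex.cpow_sub _ _ hx', Complex.cpow_one]
  rw [modelSol, e2, e1]
  have h0 := poissonInt_zero_ne_zero hν
  generalize (x : ℂ) ^ (-1/2 + ν) = y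
  simp only [Pi.add_apply, Pi.mul_apply]
  push_cast at hode ⊢
  field_simp
  linear_combination 16 * y * (μ : ℂ) * (x : ℂ) * hode

lemma modelSol_tendsto {ν : ℂ} (hν : ν.re = 0) (μ : ℝ) :
    Tendsto (fun x : ℝ => (x : ℂ) ^ (-1/2 - ν) * modelSol ν μ x) (𝓝[>] 0) (𝓝 1) := by
  have h0 := poissonInt_zero_ne_zero hν
  have h1 : Tendsto (fun x : ℝ => poissonInt ν 0 (μ * x) / poissonInt ν 0 0) (𝓝[>] 0) (𝓝 1) := by
    have h2 := ((hasDerivAt_poissonInt_comp hν 0 μ 0).continuousAt.tendsto.div_const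
      (poissonInt ν 0 0)).mono_left (nhdsWithin_le_nhds (s := Set.Ioi 0))
    simpa [h0] using h2
  refine h1.congr' ?_
  filter_upwards [self_mem_nhdsWithin] with x hx
  have hx' : (x : ℂ) ≠ 0 := by exact_mod_cast (Set.mem_Ioi.1 hx).ne'
  rw [modelSol, ← mul_assoc, ← Complex.cpow_add _ _ hx']
  ring_nf
  simp

lemma exists_norm_modelSol_le {ν : ℂ} (hν : ν.re = 0) :
    ∃ C : ℝ, 0 < C ∧ ∀ μ : ℝ, 0 < μ →
      (∀ x ∈ Set.Ioc 0 (1 / μ), ‖modelSol ν μ x‖ ≤ C * √x) ∧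
      ∀ x : ℝ, 1 / μ ≤ x → ‖modelSol ν μ x‖ ≤ C * (μ ^ (-1/2 : ℝ) * Real.exp (μ * x)) := by
  obtain ⟨C, hC, h1, h2⟩ := norm_poissonInt_le hν
  have h0 : 0 < ‖poissonInt ν 0 0‖ := norm_pos_iff.2 (poissonInt_zero_ne_zero hν)
  refine ⟨C / ‖poissonInt ν 0 0‖, by positivity, fun μ hμ => ⟨fun x hx => ?_, fun x hx => ?_⟩⟩
  · have hμx : μ * x ≤ 1 := by
      have := hx.2
      rw [le_div_iff₀ hμ] at this
      linarith
    rw [modelSol, norm_mul, norm_div, norm_cpow_half_add hν hx.1, mul_comm]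
    gcongr
    exact h1 _ ⟨mul_nonneg hμ.le hx.1.le, hμx⟩
  · have hxp : 0 < x := lt_of_lt_of_le (by positivity) hx
    have hμx : 1 ≤ μ * x := by
      rw [div_le_iff₀ hμ] at hx
      linarith
    have h3 := h2 _ hμx
    rw [modelSol, norm_mul, norm_div, norm_cpow_half_add hν hxp]
    have e : √x * (μ * x) ^ (-1/2 : ℝ) = μ ^ (-1/2 : ℝ) := by
      rw [Real.mul_rpow hμ.le hxp.le, Real.sqrt_eq_rpow, mul_left_comm, ← Real.rpow_add hxp]
      norm_num
    calc √x * (‖poissonInt ν 0 (μ * x)‖ / ‖poissonInt ν 0 0‖) ≤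
        √x * (C * (μ * x) ^ (-1/2 : ℝ) * Real.exp (μ * x) / ‖poissonInt ν 0 0‖) := by gcongr
      _ = C / ‖poissonInt ν 0 0‖ * ((√x * (μ * x) ^ (-1/2 : ℝ)) * Real.exp (μ * x)) := by ring
      _ = _ := by rw [e]

lemma modelConst_eq {ν : ℂ} (hν : ν.re = 0) :
    modelConst ν = Complex.Gamma (ν + 1/2) / (2 ^ (ν + 1/2) * poissonInt ν 0 0) := by
  have h0 := poissonInt_zero_ne_zero hν
  have h1 := poissonInt_zero_mul hν
  have h2 := Complex.Gamma_mul_Gamma_add_half (ν + 1/2)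
  have h3 : Complex.Gamma (ν + 1/2) ≠ 0 := Complex.Gamma_ne_zero_of_re_pos (by simp [hν])
  have hpi : ((√Real.pi : ℝ) : ℂ) ≠ 0 := by
    exact_mod_cast (Real.sqrt_pos.2 Real.pi_pos).ne'
  have e1 : ν + 1/2 + 1/2 = 1 + ν := by ring
  have e2 : 2 * (ν + 1/2) = 2 * ν + 1 := by ring
  rw [e1, e2] at h2
  have e3 : (2 : ℂ) ^ (1 - (2 * ν + 1)) * ((2 : ℂ) ^ (ν - 1/2) * 2 ^ (ν + 1/2)) = 1 := by
    rw [← Complex.cpow_add _ _ two_ne_zero, ← Complex.cpow_add _ _ two_ne_zero]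
    ring_nf
    simp
  have e4 : (2 : ℂ) ^ (ν + 1/2) ≠ 0 := by simp [Complex.cpow_eq_zero_iff]
  rw [modelConst, div_eq_div_iff hpi (mul_ne_zero e4 h0)]
  apply mul_left_cancel₀ h3
  linear_combination (2 : ℂ) ^ (ν - 1/2) * 2 ^ (ν + 1/2) * poissonInt ν 0 0 * h2 -
    ((√Real.pi : ℝ) : ℂ) * h1 +
    Complex.Gamma (2 * ν + 1) * poissonInt ν 0 0 * ((√Real.pi : ℝ) : ℂ) * e3

lemma poissonInt_tendsto_model {ν : ℂ} (hν : ν.re = 0) {k : ℕ} (hk : k ≤ 1) :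
    Tendsto (fun s : ℝ => (s : ℂ) ^ (ν + 1/2) * (poissonInt ν k s / poissonInt ν 0 0) *
      Complex.exp (-s)) atTop (𝓝 (modelConst ν)) := by
  rw [modelConst_eq hν]
  have h := (poissonInt_tendsto hν hk).div_const (2 ^ (ν + 1/2) * poissonInt ν 0 0)
  refine h.congr' ?_
  filter_upwards [eventually_gt_atTop 0] with s hs
  have e4 : (2 : ℂ) ^ (ν + 1/2) ≠ 0 := by simp [Complex.cpow_eq_zero_iff]
  have h0 := poissonInt_zero_ne_zero hν
  have e : ((2 : ℂ) * s) ^ (ν + 1/2) = (2 : ℂ) ^ (ν + 1/2) * (s : ℂ) ^ (ν + 1/2) := by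
    have := Complex.mul_cpow_ofReal_nonneg (zero_le_two (α := ℝ)) hs.le (ν + 1/2)
    simpa using this
  rw [e]
  field_simp

lemma modelSol_tendsto_atTop {ν : ℂ} (hν : ν.re = 0) {a : ℝ} (ha : 0 < a) :
    Tendsto (fun μ : ℝ => modelSol ν μ a * (μ : ℂ) ^ (1/2 + ν) * Complex.exp (-(μ * a : ℝ)))
      atTop (𝓝 (modelConst ν)) := by
  have h := (poissonInt_tendsto_model hν (k := 0) (by norm_num)).comp
    (tendsto_id.atTop_mul_const ha)
  refine h.congr' ?_
  filter_upwards [eventually_gt_atTop 0] with μ hμ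
  have e := Complex.mul_cpow_ofReal_nonneg hμ.le ha.le (ν + 1/2)
  simp only [Function.comp_apply, id_eq]
  rw [Complex.ofReal_mul, e, modelSol, add_comm (1/2) ν]
  ring

lemma modelDeriv_tendsto_atTop {ν : ℂ} (hν : ν.re = 0) {a : ℝ} (ha : 0 < a) :
    Tendsto (fun μ : ℝ => modelDeriv ν μ a * (μ : ℂ) ^ (-1/2 + ν) * Complex.exp (-(μ * a : ℝ)))
      atTop (𝓝 (modelConst ν)) := by
  have hinv : Tendsto (fun s : ℝ => (1/2 + ν) * (s : ℂ)⁻¹) atTop (𝓝 0) := by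
    have h1 : Tendsto (fun s : ℝ => ((s⁻¹ : ℝ) : ℂ)) atTop (𝓝 ((0 : ℝ) : ℂ)) :=
      (Complex.continuous_ofReal.tendsto 0).comp tendsto_inv_atTop_zero
    simpa using h1.const_mul (1/2 + ν)
  have h := (((hinv.mul (poissonInt_tendsto_model hν (k := 0) (by norm_num))).add
    (poissonInt_tendsto_model hν (k := 1) le_rfl))).comp (tendsto_id.atTop_mul_const ha)
  rw [zero_mul, zero_add] at h
  refine h.congr' ?_
  filter_upwards [eventually_gt_atTop 0] with μ hμ
  have hμa : ((μ * a : ℝ) : ℂ) ≠ 0 := by exact_mod_cast (mul_pos hμ ha).ne'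
  have e := Complex.mul_cpow_ofReal_nonneg hμ.le ha.le (-1/2 + ν)
  have e1 : ((μ * a : ℝ) : ℂ) ^ (ν + 1/2) = ((μ * a : ℝ) : ℂ) ^ (-1/2 + ν) * (μ * a : ℝ) := by
    rw [cpow_neg_half_add_mul ν hμa, add_comm]
  have e2 : (μ : ℂ) ^ (-1/2 + ν) * (a : ℂ) ^ (-1/2 + ν) = ((μ * a : ℝ) : ℂ) ^ (-1/2 + ν) := by
    rw [Complex.ofReal_mul, e]
  simp only [Function.comp_apply, id_eq]
  rw [e1, ← e2, modelDeriv]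
  field_simp

lemma intervalIntegrable_min_mul {q₀ : ℝ → ℂ} {a b : ℝ} (ha : 0 < a) (hab : a < b)
    (hq : ContinuousOn q₀ (Set.Ioo 0 b))
    (hqi : IntegrableOn (fun t => t * ‖q₀ t‖) (Set.Ioo 0 a)) {h : ℝ} (hh : 0 < h) :
    IntervalIntegrable (fun t => min t h * ‖q₀ t‖) volume 0 a := by
  rw [intervalIntegrable_iff_integrableOn_Ioo_of_le ha.le]
  refine hqi.mono' ?_ ?_
  · refine ContinuousOn.aestronglyMeasurable ?_ measurableSet_Ioo
    exact (by fun_prop : Continuous fun t : ℝ => min t h).continuousOn.mul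
      (hq.mono (Set.Ioo_subset_Ioo_right hab.le)).norm
  · refine (ae_restrict_iff' measurableSet_Ioo).2 (Eventually.of_forall fun t ht => ?_)
    rw [norm_mul, norm_norm, Real.norm_eq_abs, abs_of_pos (lt_min ht.1 hh)]
    gcongr
    exact min_le_left _ _

lemma exists_primitive_min_mul {q₀ : ℝ → ℂ} {a b : ℝ} (ha : 0 < a) (hab : a < b)
    (hq : ContinuousOn q₀ (Set.Ioo 0 b))
    (hqi : IntegrableOn (fun t => t * ‖q₀ t‖) (Set.Ioo 0 a)) {h : ℝ} (hh : 0 < h) :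
    ∃ W : ℝ → ℝ, (∀ x ∈ Set.Ioo 0 a, HasDerivAt W (min x h * ‖q₀ x‖) x) ∧
      ContinuousOn W (Set.Icc 0 a) ∧ W 0 = 0 ∧ MonotoneOn W (Set.Icc 0 a) ∧
      W a = ∫ t in (0 : ℝ)..a, min t h * ‖q₀ t‖ := by
  have hI := intervalIntegrable_min_mul ha hab hq hqi hh
  have hcont : ContinuousOn (fun t => min t h * ‖q₀ t‖) (Set.Ioo 0 a) :=
    (by fun_prop : Continuous fun t : ℝ => min t h).continuousOn.mul
      (hq.mono (Set.Ioo_subset_Ioo_right hab.le)).norm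
  have hd : ∀ x ∈ Set.Ioo 0 a,
      HasDerivAt (fun x => ∫ t in (0 : ℝ)..x, min t h * ‖q₀ t‖) (min x h * ‖q₀ x‖) x := by
    intro x hx
    refine intervalIntegral.integral_hasDerivAt_right
      (hI.mono_set (Set.uIcc_subset_uIcc_left ?_))
      (hcont.stronglyMeasurableAtFilter isOpen_Ioo x hx)
      (hcont.continuousAt (isOpen_Ioo.mem_nhds hx))
    rw [Set.uIcc_of_le ha.le]
    exact ⟨hx.1.le, hx.2.le⟩
  have hc : ContinuousOn (fun x => ∫ t in (0 : ℝ)..x, min t h * ‖q₀ t‖) (Set.Icc 0 a) := by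
    rw [← Set.uIcc_of_le ha.le]
    refine intervalIntegral.continuousOn_primitive_interval ?_
    rw [Set.uIcc_of_le ha.le, integrableOn_Icc_iff_integrableOn_Ioc]
    exact (intervalIntegrable_iff_integrableOn_Ioc_of_le ha.le).1 hI
  refine ⟨_, hd, hc, by simp, monotoneOn_of_deriv_nonneg (convex_Icc 0 a) hc ?_ ?_, rfl⟩
  · rw [interior_Icc]
    exact fun x hx => (hd x hx).differentiableAt.differentiableWithinAt
  · rw [interior_Icc]
    intro x hx
    rw [(hd x hx).deriv]
    exact mul_nonneg (le_min hx.1.le hh.le) (norm_nonneg _)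

lemma integral_min_mul_tendsto_zero {q₀ : ℝ → ℂ} {a b : ℝ} (ha : 0 < a) (hab : a < b)
    (hq : ContinuousOn q₀ (Set.Ioo 0 b))
    (hqi : IntegrableOn (fun t => t * ‖q₀ t‖) (Set.Ioo 0 a)) :
    Tendsto (fun μ : ℝ => ∫ t in (0 : ℝ)..a, min t (1 / μ) * ‖q₀ t‖) atTop (𝓝 0) := by
  simp only [intervalIntegral.integral_of_le ha.le, integral_Ioc_eq_integral_Ioo]
  have h := tendsto_integral_filter_of_dominated_convergence
    (μ := volume.restrict (Set.Ioo 0 a)) (l := atTop)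
    (F := fun (μ : ℝ) t => min t (1 / μ) * ‖q₀ t‖) (f := fun _ => 0)
    (fun t => t * ‖q₀ t‖) ?_ ?_ hqi ?_
  · simpa using h
  · refine Eventually.of_forall fun μ => ContinuousOn.aestronglyMeasurable ?_ measurableSet_Ioo
    exact (by fun_prop : Continuous fun t : ℝ => min t (1 / μ)).continuousOn.mul
      (hq.mono (Set.Ioo_subset_Ioo_right hab.le)).norm
  · filter_upwards [eventually_gt_atTop 0] with μ hμ
    refine (ae_restrict_iff' measurableSet_Ioo).2 (Eventually.of_forall fun t ht => ?_)
    rw [norm_mul, norm_norm, Real.norm_eq_abs, abs_of_pos (lt_min ht.1 (by positivity))]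
    gcongr
    exact min_le_left _ _
  · refine (ae_restrict_iff' measurableSet_Ioo).2 (Eventually.of_forall fun t ht => ?_)
    have h1 : Tendsto (fun μ : ℝ => min t (1 / μ)) atTop (𝓝 (min t 0)) := by
      refine tendsto_const_nhds.min ?_
      exact (tendsto_inv_atTop_zero (𝕜 := ℝ)).congr fun μ => (one_div μ).symm
    rw [min_eq_right ht.1.le] at h1
    simpa using h1.mul_const ‖q₀ t‖

lemma eventually_norm_le_sqrt {ν : ℂ} (hν : ν.re = 0) {f : ℝ → ℂ}
    (hf : Tendsto (fun x : ℝ => (x : ℂ) ^ (-1/2 - ν) * f x) (𝓝[>] 0) (𝓝 1)) :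
    ∀ᶠ x in 𝓝[>] (0 : ℝ), ‖f x‖ ≤ 2 * √x := by
  have h := hf.norm.eventually_le_const (by simp : ‖(1 : ℂ)‖ < 2)
  filter_upwards [h, self_mem_nhdsWithin] with x hx hx0
  have hx0' : 0 < x := hx0
  rw [norm_mul, Complex.norm_cpow_eq_rpow_re_of_pos hx0'] at hx
  have e : (-1/2 - ν).re = -(1/2 : ℝ) := by simp [hν]; norm_num
  rw [e, Real.rpow_neg hx0'.le, ← Real.sqrt_eq_rpow, inv_mul_le_iff₀ (Real.sqrt_pos.2 hx0')] at hx
  linarith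

lemma eulerCoeff_sub_modelSol_tendsto_zero {ν : ℂ} (hν : ν.re = 0) (hν0 : ν ≠ 0) {a μ : ℝ}
    (ha : 0 < a) {q₀ u u₁ : ℝ → ℂ} (hq : ContinuousOn q₀ (Set.Ioo 0 a))
    (hqi : IntegrableOn (fun t => t * ‖q₀ t‖) (Set.Ioo 0 a))
    (hu : ∀ x ∈ Set.Ioo 0 a, HasDerivAt u (u₁ x) x)
    (hD : ∀ x ∈ Set.Ioo 0 a, HasDerivAt (fun x => u x - modelSol ν μ x)
      (u₁ x - modelDeriv ν μ x) x)
    (hD₁ : ∀ x ∈ Set.Ioo 0 a, HasDerivAt (fun x => u₁ x - modelDeriv ν μ x)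
      ((ν ^ 2 - 1/4) / x ^ 2 * (u x - modelSol ν μ x) +
        (μ ^ 2 * (u x - modelSol ν μ x) + q₀ x * u x)) x)
    (hlim : Tendsto (fun x : ℝ => (x : ℂ) ^ (-1/2 - ν) * u x) (𝓝[>] 0) (𝓝 1)) :
    Tendsto (eulerCoeff ν (fun x => u x - modelSol ν μ x) (fun x => u₁ x - modelDeriv ν μ x))
      (𝓝[>] 0) (𝓝 0) ∧
    Tendsto (eulerCoeff (-ν) (fun x => u x - modelSol ν μ x) (fun x => u₁ x - modelDeriv ν μ x))
      (𝓝[>] 0) (𝓝 0) := by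
  have hφ := modelSol_tendsto hν μ
  have h2 := (eventually_norm_le_sqrt hν hlim).and (eventually_norm_le_sqrt hν hφ)
  obtain ⟨δ', hδ', hb⟩ := (mem_nhdsGT_iff_exists_Ioo_subset' ha).1 h2
  set δ := min δ' a
  have hδ : 0 < δ := lt_min hδ' ha
  have hsub : Set.Ioo 0 δ ⊆ Set.Ioo 0 a := Set.Ioo_subset_Ioo_right (min_le_right _ _)
  have hRc : ContinuousOn (fun x => μ ^ 2 * (u x - modelSol ν μ x) + q₀ x * u x)
      (Set.Ioo 0 δ) := by
    refine ContinuousOn.add (continuousOn_const.mul fun x hx =>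
      (hD x (hsub hx)).continuousAt.continuousWithinAt) ((hq.mono hsub).mul fun x hx =>
      (hu x (hsub hx)).continuousAt.continuousWithinAt)
  refine eulerCoeff_tendsto_zero hν hν0 hδ (fun x hx => hD x (hsub hx))
    (fun x hx => hD₁ x (hsub hx)) hRc ?_ ?_
  · have hdom : IntegrableOn (fun x => 4 * μ ^ 2 * x + 2 * (x * ‖q₀ x‖)) (Set.Ioo 0 δ) := by
      refine Integrable.add ?_ ((hqi.mono_set hsub).const_mul 2)
      exact ((by fun_prop : Continuous fun x : ℝ => 4 * μ ^ 2 * x).integrableOn_Icc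
        (a := 0) (b := δ)).mono_set Set.Ioo_subset_Icc_self
    refine hdom.mono' ((Real.continuous_sqrt.continuousOn.mul hRc.norm).aestronglyMeasurable
      measurableSet_Ioo) ((ae_restrict_iff' measurableSet_Ioo).2 (Eventually.of_forall ?_))
    intro x hx
    obtain ⟨h3, h4⟩ := hb ⟨hx.1, hx.2.trans_le (min_le_left _ _)⟩
    have hs : 0 ≤ √x := Real.sqrt_nonneg _
    have hss : √x * √x = x := Real.mul_self_sqrt hx.1.le
    rw [norm_mul, norm_norm, Real.norm_eq_abs, abs_of_nonneg hs]
    calc √x * ‖μ ^ 2 * (u x - modelSol ν μ x) + q₀ x * u x‖ ≤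
        √x * (μ ^ 2 * (2 * √x + 2 * √x) + ‖q₀ x‖ * (2 * √x)) := by
          gcongr
          refine (norm_add_le _ _).trans ?_
          rw [norm_mul, norm_mul, norm_pow, Complex.norm_real, Real.norm_eq_abs, sq_abs]
          gcongr
          exact (norm_sub_le _ _).trans (add_le_add h3 h4)
      _ = 4 * μ ^ 2 * (√x * √x) + 2 * ((√x * √x) * ‖q₀ x‖) := by ring
      _ = _ := by rw [hss]
  · have h3 := hlim.sub hφ
    rw [sub_self] at h3
    refine h3.congr fun x => ?_
    ring

lemma tendsto_atTop_of_regularSingular {ν : ℂ} (hν : ν.re = 0) (hν0 : ν ≠ 0) {a b : ℝ}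
    (ha : 0 < a) (hab : a < b) {q₀ : ℝ → ℂ} (hq : ContinuousOn q₀ (Set.Ioo 0 b))
    (hqi : IntegrableOn (fun t => t * ‖q₀ t‖) (Set.Ioo 0 a)) {u u₁ : ℝ → ℝ → ℂ}
    (hu : ∀ μ : ℝ, 0 < μ → ∀ x ∈ Set.Ioo 0 b, HasDerivAt (u μ) (u₁ μ x) x)
    (hu₁ : ∀ μ : ℝ, 0 < μ → ∀ x ∈ Set.Ioo 0 b, HasDerivAt (u₁ μ)
      ((ν ^ 2 - 1/4) / x ^ 2 * u μ x + (μ ^ 2 * u μ x + q₀ x * u μ x)) x)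
    (hlim : ∀ μ : ℝ, 0 < μ →
      Tendsto (fun x : ℝ => (x : ℂ) ^ (-1/2 - ν) * u μ x) (𝓝[>] 0) (𝓝 1)) :
    Tendsto (fun μ : ℝ => u μ a * (μ : ℂ) ^ (1/2 + ν) * Complex.exp (-(μ * a : ℝ)))
      atTop (𝓝 (modelConst ν)) ∧
    Tendsto (fun μ : ℝ => u₁ μ a * (μ : ℂ) ^ (-1/2 + ν) * Complex.exp (-(μ * a : ℝ)))
      atTop (𝓝 (modelConst ν)) := by
  obtain ⟨C, hC, hφ⟩ := exists_norm_modelSol_le hν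
  obtain ⟨K, hK0, hK⟩ := exists_energy_le hν hν0 C
  set ε : ℝ → ℝ := fun μ => (∫ t in (0 : ℝ)..a, min t (1 / μ) * ‖q₀ t‖) + 1 / μ with hεdef
  have hεlim : Tendsto ε atTop (𝓝 0) := by
    simpa [hεdef] using (integral_min_mul_tendsto_zero ha hab hq hqi).add (tendsto_inv_atTop_zero (𝕜 := ℝ))
  have hbound : ∀ᶠ μ : ℝ in atTop, 0 ≤ ε μ ∧
      ‖u₁ μ a - modelDeriv ν μ a‖ ^ 2 + μ ^ 2 * ‖u μ a - modelSol ν μ a‖ ^ 2 ≤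
        K * ε μ ^ 2 * μ * Real.exp (2 * (μ * a)) := by
    filter_upwards [eventually_gt_atTop 0, eventually_gt_atTop (1 / a),
      hεlim.eventually_le_const one_pos] with μ hμ hμa hε1
    have hh : 0 < 1 / μ := by positivity
    obtain ⟨W, hW, hWc, hW0, hWm, hWa⟩ := exists_primitive_min_mul ha hab hq hqi hh
    have hWa0 : 0 ≤ W a := hW0 ▸ hWm ⟨le_rfl, ha.le⟩ ⟨ha.le, le_rfl⟩ ha.le
    have hεpos : 0 < ε μ := by
      simp only [hεdef]
      rw [← hWa]
      positivity
    have hxa : 1 / μ < a := by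
      rw [div_lt_iff₀ hμ]
      rwa [div_lt_iff₀ ha, mul_comm] at hμa
    have hD : ∀ x ∈ Set.Ioo 0 b, HasDerivAt (fun x => u μ x - modelSol ν μ x)
        (u₁ μ x - modelDeriv ν μ x) x := fun x hx =>
      (hu μ hμ x hx).sub (hasDerivAt_modelSol hν μ hx.1)
    have hD₁ : ∀ x ∈ Set.Ioo 0 b, HasDerivAt (fun x => u₁ μ x - modelDeriv ν μ x)
        ((ν ^ 2 - 1/4) / x ^ 2 * (u μ x - modelSol ν μ x) +
          (μ ^ 2 * (u μ x - modelSol ν μ x) + q₀ x * u μ x)) x := fun x hx =>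
      ((hu₁ μ hμ x hx).sub (hasDerivAt_modelDeriv hν μ hx.1)).congr_deriv (by ring)
    have hsub : Set.Ioo 0 a ⊆ Set.Ioo 0 b := Set.Ioo_subset_Ioo_right hab.le
    obtain ⟨hP, hM⟩ := eulerCoeff_sub_modelSol_tendsto_zero hν hν0 ha (hq.mono hsub) hqi
      (fun x hx => hu μ hμ x (hsub hx)) (fun x hx => hD x (hsub hx))
      (fun x hx => hD₁ x (hsub hx)) (hlim μ hμ)
    refine ⟨hεpos.le, hK μ (ε μ) a q₀ _ _ (modelSol ν μ) W hμ hxa hεpos hε1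
      (fun x hx => hD x ⟨hx.1, hx.2.trans_lt hab⟩)
      (fun x hx => (hD₁ x ⟨hx.1, hx.2.trans_lt hab⟩).congr_deriv (by simp))
      (fun x hx _ => hW x hx) hWc hW0 hWm ?_ (hφ μ hμ).1 (fun x hx => (hφ μ hμ).2 x hx.1) hP hM⟩
    simp only [hεdef]
    rw [← hWa]
    linarith
  have hlim0 : Tendsto (fun μ => √K * ε μ) atTop (𝓝 0) := by
    simpa using hεlim.const_mul √K
  have key : ∀ {μ z s : ℝ}, 0 < μ → 0 ≤ z → 0 ≤ s → z ^ 2 ≤ K * s ^ 2 * μ * Real.exp (2 * (μ * a)) →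
      z * (μ ^ (-1/2 : ℝ) * Real.exp (-(μ * a))) ≤ √K * s := by
    intro μ z s hμ hz hs h
    refine le_of_sq_le_sq ?_ (by positivity)
    have e1 : (μ ^ (-1/2 : ℝ)) ^ 2 * μ = 1 := by
      rw [← Real.rpow_natCast, ← Real.rpow_mul hμ.le]
      norm_num
      rw [Real.rpow_neg_one]
      field_simp
    have e2 : Real.exp (2 * (μ * a)) * Real.exp (-(μ * a)) ^ 2 = 1 := by
      rw [← Real.exp_nat_mul, ← Real.exp_add]
      simp
    calc (z * (μ ^ (-1/2 : ℝ) * Real.exp (-(μ * a)))) ^ 2 =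
        z ^ 2 * ((μ ^ (-1/2 : ℝ)) ^ 2 * Real.exp (-(μ * a)) ^ 2) := by ring
      _ ≤ K * s ^ 2 * μ * Real.exp (2 * (μ * a)) *
          ((μ ^ (-1/2 : ℝ)) ^ 2 * Real.exp (-(μ * a)) ^ 2) := by gcongr
      _ = K * s ^ 2 * ((μ ^ (-1/2 : ℝ)) ^ 2 * μ) *
          (Real.exp (2 * (μ * a)) * Real.exp (-(μ * a)) ^ 2) := by ring
      _ = (√K * s) ^ 2 := by rw [e1, e2, mul_pow, Real.sq_sqrt hK0]; ring
  have hexp : ∀ x : ℝ, ‖Complex.exp (-(x : ℂ))‖ = Real.exp (-x) := fun x => by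
    rw [Complex.norm_exp]; simp
  constructor
  · have h0 : Tendsto (fun μ : ℝ => (u μ a - modelSol ν μ a) * (μ : ℂ) ^ (1/2 + ν) *
        Complex.exp (-(μ * a : ℝ))) atTop (𝓝 0) := by
      refine squeeze_zero_norm' ?_ hlim0
      filter_upwards [hbound, eventually_gt_atTop 0] with μ hb hμ
      rw [norm_mul, norm_mul, hexp, Complex.norm_cpow_eq_rpow_re_of_pos hμ]
      have e : (1/2 + ν).re = 1 + -1/2 := by simp [hν]; norm_num
      rw [e, Real.rpow_add hμ, Real.rpow_one]
      refine le_trans (le_of_eq ?_) (key (z := μ * ‖u μ a - modelSol ν μ a‖) hμ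
        (by positivity) hb.1 ?_)
      · ring
      · rw [mul_pow]
        linarith [hb.2, sq_nonneg ‖u₁ μ a - modelDeriv ν μ a‖]
    have h1 := h0.add (modelSol_tendsto_atTop hν ha)
    rw [zero_add] at h1
    refine h1.congr fun μ => ?_
    ring
  · have h0 : Tendsto (fun μ : ℝ => (u₁ μ a - modelDeriv ν μ a) * (μ : ℂ) ^ (-1/2 + ν) *
        Complex.exp (-(μ * a : ℝ))) atTop (𝓝 0) := by
      refine squeeze_zero_norm' ?_ hlim0
      filter_upwards [hbound, eventually_gt_atTop 0] with μ hb hμ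
      rw [norm_mul, norm_mul, hexp, Complex.norm_cpow_eq_rpow_re_of_pos hμ]
      have e : (-1/2 + ν).re = -1/2 := by simp [hν]
      rw [e, mul_assoc]
      refine key hμ (norm_nonneg _) hb.1 ?_
      have : 0 ≤ μ ^ 2 * ‖u μ a - modelSol ν μ a‖ ^ 2 := by positivity
      linarith [hb.2]
    have h1 := h0.add (modelDeriv_tendsto_atTop hν ha)
    rw [zero_add] at h1
    refine h1.congr fun μ => ?_
    ring

lemma SolvesRadialODE.comp_sub_left {A : ℝ} {q : ℝ → ℂ} {μ : ℂ} {u : ℝ → ℂ}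
    (h : SolvesRadialODE A q μ u) :
    SolvesRadialODE A (fun x => q (A - x)) μ (fun x => u (A - x)) := by
  intro x hx
  have hx' : A - x ∈ Set.Ioo 0 A := ⟨by linarith [hx.2], by linarith [hx.1]⟩
  obtain ⟨h1, h2, h3, h4⟩ := h (A - x) hx'
  have e1 : deriv (fun x => u (A - x)) = fun x => -deriv u (A - x) :=
    funext fun x => deriv_comp_const_sub u A x
  have e2 : deriv (fun x => -deriv u (A - x)) = fun x => deriv (deriv u) (A - x) :=
    funext fun x => by
      have := deriv_comp_const_sub (deriv u) A x
      rw [deriv.fun_neg, this, neg_neg]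
  have hsub : DifferentiableAt ℝ (fun x => A - x) x := by fun_prop
  rw [e1, e2]
  exact ⟨h1.comp x hsub, (h2.comp x hsub).neg,
    ContinuousAt.comp (f := fun x => A - x) h3 hsub.continuousAt, h4⟩

lemma integrableOn_comp_sub_left {A : ℝ} {q₁ : ℝ → ℂ}
    (h : IntegrableOn (fun t : ℝ => (A - t) * ‖q₁ t‖) (Set.Ioo (A/2) A)) :
    IntegrableOn (fun t : ℝ => t * ‖q₁ (A - t)‖) (Set.Ioo 0 (A/2)) := by
  have h1 := ((Measure.measurePreserving_sub_left volume A).integrableOn_comp_preimage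
    (Homeomorph.subLeft A).measurableEmbedding).2 h
  rw [Set.preimage_const_sub_Ioo] at h1
  have e : A - A/2 = A/2 := by ring
  rw [sub_self, e] at h1
  simpa [Function.comp_def] using h1

lemma tendsto_atTop_of_solvesRadialODE {ν c : ℂ} (hν : ν.re = 0) (hν0 : ν ≠ 0) {A : ℝ}
    (hA : 0 < A) {q q₀ : ℝ → ℂ} (hqc : ContinuousOn q (Set.Ioo 0 A))
    (hq : ∀ x ∈ Set.Ioo 0 A, q x = (ν ^ 2 - 1/4) / (x : ℂ) ^ 2 + q₀ x)
    (hqi : IntegrableOn (fun t => t * ‖q₀ t‖) (Set.Ioo 0 (A/2))) {S : ℝ → ℂ → ℂ}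
    (hS : ∀ μ : ℂ, SolvesRadialODE A q μ (fun x => S x μ))
    (hlim : ∀ μ : ℂ,
      Tendsto (fun x : ℝ => c * S x μ * (x : ℂ) ^ (-1/2 - ν)) (𝓝[>] 0) (𝓝 1)) :
    Tendsto (fun μ : ℝ => c * S (A/2) μ * (μ : ℂ) ^ (1/2 + ν) * Complex.exp (-(μ * (A/2) : ℝ)))
      atTop (𝓝 (modelConst ν)) ∧
    Tendsto (fun μ : ℝ => c * deriv (fun x => S x μ) (A/2) * (μ : ℂ) ^ (-1/2 + ν) *
      Complex.exp (-(μ * (A/2) : ℝ))) atTop (𝓝 (modelConst ν)) := by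
  have hq₀c : ContinuousOn q₀ (Set.Ioo 0 A) := by
    have h1 : ContinuousOn (fun x : ℝ => (ν ^ 2 - 1/4) / (x : ℂ) ^ 2) (Set.Ioo 0 A) := by
      refine continuousOn_const.div (by fun_prop) fun x hx => ?_
      exact pow_ne_zero 2 (by exact_mod_cast hx.1.ne')
    exact (hqc.sub h1).congr fun x hx => by
      rw [Pi.sub_apply, hq x hx, add_sub_cancel_left]
  refine tendsto_atTop_of_regularSingular hν hν0 (half_pos hA) (half_lt_self hA) hq₀c hqi
    (u := fun μ x => c * S x μ) (u₁ := fun μ x => c * deriv (fun x => S x μ) x)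
    (fun μ _ x hx => ((hS μ x hx).1.hasDerivAt).const_mul c) (fun μ _ x hx => ?_)
    (fun μ _ => (hlim μ).congr fun x => mul_comm _ _)
  obtain ⟨-, h2, -, h4⟩ := hS μ x hx
  refine (h2.hasDerivAt.const_mul c).congr_deriv ?_
  rw [hq x hx] at h4
  linear_combination -c * h4

/-- Asymptotics of the characteristic functions along the positive real axis:
`Δ(μ)μ^{−2iλ}e^{−μA} → Γ(1−iλ)²2^{−2iλ}/π` and
`δ(μ)e^{−μA} → Γ(1−iλ)Γ(1+iλ)/(2iλπ)` as `μ → +∞`, `μ ∈ ℝ`. -/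
theorem stmt16 (lam A : ℝ) (hlam : lam ≠ 0) (hA : 0 < A)
    (q : ℝ → ℂ) (S10 S20 S11 : ℝ → ℂ → ℂ)
    (hq : IsAdmissible lam A q)
    (hS : IsNormalizedFS lam A q S10 S20 S11) :
    Tendsto (fun μ : ℝ => charFun A S10 S11 μ *
        (μ : ℂ) ^ (-(2 * Complex.I * (lam : ℂ))) * Complex.exp (-(μ : ℂ) * A))
      atTop
      (𝓝 (Complex.Gamma (1 - Complex.I * lam) ^ 2 *
        (2 : ℂ) ^ (-(2 * Complex.I * (lam : ℂ))) / (Real.pi : ℂ))) ∧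
    Tendsto (fun μ : ℝ => deltaFun A S20 S11 μ * Complex.exp (-(μ : ℂ) * A))
      atTop
      (𝓝 (Complex.Gamma (1 - Complex.I * lam) * Complex.Gamma (1 + Complex.I * lam) /
        (2 * Complex.I * lam * Real.pi))) := by
  obtain ⟨hqc, ⟨q₀, hq₀, hq₀i⟩, q₁, hq₁, hq₁i⟩ := hq
  obtain ⟨hode, -, hasy⟩ := hS
  have hlam' : (lam : ℂ) ≠ 0 := by exact_mod_cast hlam
  set ν : ℂ := Complex.I * lam with hνdef
  have hν : ν.re = 0 := by simp [hνdef]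
  have hν0 : ν ≠ 0 := mul_ne_zero Complex.I_ne_zero hlam'
  have hν2 : ν ^ 2 = -(lam : ℂ) ^ 2 := by rw [hνdef, mul_pow, Complex.I_sq]; ring
  have hnν : (-ν).re = 0 := by simp [hν]
  have hnν0 : -ν ≠ 0 := neg_ne_zero.2 hν0
  have hhalf : A - A/2 = A/2 := by ring
  obtain ⟨s, s₁⟩ := tendsto_atTop_of_solvesRadialODE (c := 1) hnν hnν0 hA hqc
    (fun x hx => by rw [hq₀ x hx, neg_sq, hν2]) hq₀i (fun μ => (hode μ).1)
    (fun μ => by simpa [sub_neg_eq_add] using (hasy μ).1)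
  obtain ⟨t, t₁⟩ := tendsto_atTop_of_solvesRadialODE (c := 2 * ν) hν hν0 hA hqc
    (fun x hx => by rw [hq₀ x hx, hν2]) hq₀i (fun μ => (hode μ).2.1)
    (fun μ => by simpa [hνdef, mul_assoc] using (hasy μ).2.1)
  have hmaps : Set.MapsTo (fun x => A - x) (Set.Ioo 0 A) (Set.Ioo 0 A) := fun x hx =>
    ⟨by linarith [hx.2], by linarith [hx.1]⟩
  have hrefl : Tendsto (fun x => A - x) (𝓝[>] 0) (𝓝[<] A) := by
    refine tendsto_nhdsWithin_iff.2 ⟨?_, ?_⟩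
    · have : ContinuousAt (fun x => A - x) 0 := by fun_prop
      simpa using this.tendsto.mono_left (nhdsWithin_le_nhds (s := Set.Ioi 0))
    · filter_upwards [self_mem_nhdsWithin] with x hx
      exact sub_lt_self A hx
  obtain ⟨r, r₁⟩ := tendsto_atTop_of_solvesRadialODE (c := 1) (S := fun x => S11 (A - x)) hnν hnν0
    hA (hqc.comp (by fun_prop) hmaps)
    (fun x hx => by
      have h := hq₁ (A - x) (hmaps hx)
      rw [Complex.ofReal_sub, sub_sub_cancel] at h
      simp only [Function.comp_apply]
      rw [h, neg_sq, hν2])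
    (integrableOn_comp_sub_left hq₁i) (fun μ => (hode μ).2.2.comp_sub_left)
    (fun μ => by
      have h := ((hasy μ).2.2).comp hrefl
      simpa [Function.comp_def, sub_neg_eq_add] using h)
  have hder : ∀ μ : ℝ, deriv (fun x => S11 (A - x) μ) (A/2) = -deriv (fun x => S11 x μ) (A/2) := by
    intro μ
    rw [deriv_comp_const_sub (fun x => S11 x μ) A, hhalf]
  simp only [hder] at r₁
  simp only [hhalf] at r
  have hexp : ∀ μ : ℝ, Complex.exp (-(μ : ℂ) * A) =
      Complex.exp (-(μ * (A/2) : ℝ)) * Complex.exp (-(μ * (A/2) : ℝ)) := by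
    intro μ
    rw [← Complex.exp_add]
    push_cast
    ring_nf
  have hpi : ((√Real.pi : ℝ) : ℂ) ^ 2 = Real.pi := by
    rw [← Complex.ofReal_pow, Real.sq_sqrt Real.pi_pos.le]
  have hpi0 : ((√Real.pi : ℝ) : ℂ) ≠ 0 := by
    exact_mod_cast (Real.sqrt_pos.2 Real.pi_pos).ne'
  constructor
  · have h := (r.mul s₁).add (r₁.mul s)
    have hc : modelConst (-ν) * modelConst (-ν) + modelConst (-ν) * modelConst (-ν) =
        Complex.Gamma (1 - ν) ^ 2 * (2 : ℂ) ^ (-(2 * Complex.I * (lam : ℂ))) / Real.pi := by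
      have e : (2 : ℂ) ^ (-(2 * Complex.I * (lam : ℂ))) = 2 * (2 ^ (-ν - 1/2) * 2 ^ (-ν - 1/2)) := by
        have e1 : -(2 * Complex.I * (lam : ℂ)) = 1 + ((-ν - 1/2) + (-ν - 1/2)) := by
          rw [hνdef]; ring
        rw [e1, Complex.cpow_add _ _ two_ne_zero, Complex.cpow_add _ _ two_ne_zero,
          Complex.cpow_one]
      rw [modelConst, e, ← hpi, ← sub_eq_add_neg]
      field_simp
      ring
    rw [hc] at h
    refine h.congr' ?_
    filter_upwards [eventually_gt_atTop 0] with μ hμ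
    have hμ0 : (μ : ℂ) ≠ 0 := by exact_mod_cast hμ.ne'
    have e : (μ : ℂ) ^ (-(2 * Complex.I * (lam : ℂ))) =
        (μ : ℂ) ^ (1/2 + -ν) * (μ : ℂ) ^ (-1/2 + -ν) := by
      rw [← Complex.cpow_add _ _ hμ0, hνdef]
      ring_nf
    rw [hexp, e, _root_.charFun]
    ring
  · have h := ((r.mul t₁).add (r₁.mul t)).div_const (2 * ν)
    have hc : (modelConst (-ν) * modelConst ν + modelConst (-ν) * modelConst ν) / (2 * ν) =
        Complex.Gamma (1 - ν) * Complex.Gamma (1 + ν) / (2 * Complex.I * lam * Real.pi) := by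
      have e : (2 : ℂ) * (2 ^ (-ν - 1/2) * 2 ^ (ν - 1/2)) = 1 := by
        have e1 : (-ν - 1/2) + (ν - 1/2) = (-1 : ℂ) := by ring
        rw [← Complex.cpow_add _ _ two_ne_zero, e1, Complex.cpow_neg_one]
        norm_num
      have e' : 2 * Complex.I * lam * Real.pi = 2 * ν * ((√Real.pi : ℝ) : ℂ) ^ 2 := by
        rw [hpi, hνdef]; ring
      rw [modelConst, modelConst, e', ← sub_eq_add_neg]
      generalize (2 : ℂ) ^ (-ν - 1/2) = y at e ⊢
      generalize (2 : ℂ) ^ (ν - 1/2) = z at e ⊢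
      field_simp
      linear_combination Complex.Gamma (1 - ν) * Complex.Gamma (1 + ν) * e
    rw [hc] at h
    refine h.congr' ?_
    filter_upwards [eventually_gt_atTop 0] with μ hμ
    have hμ0 : (μ : ℂ) ≠ 0 := by exact_mod_cast hμ.ne'
    have e1 : (μ : ℂ) ^ (1/2 + -ν) * (μ : ℂ) ^ (-1/2 + ν) = 1 := by
      rw [← Complex.cpow_add _ _ hμ0]
      ring_nf
      simp
    have e2 : (μ : ℂ) ^ (-1/2 + -ν) * (μ : ℂ) ^ (1/2 + ν) = 1 := by
      rw [← Complex.cpow_add _ _ hμ0]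
      ring_nf
      simp
    rw [hexp, deltaFun]
    set E := Complex.exp (-(μ * (A/2) : ℝ))
    generalize (μ : ℂ) ^ (1/2 + -ν) = y₁ at e1 ⊢
    generalize (μ : ℂ) ^ (-1/2 + ν) = y₂ at e1 ⊢
    generalize (μ : ℂ) ^ (-1/2 + -ν) = y₃ at e2 ⊢
    generalize (μ : ℂ) ^ (1/2 + ν) = y₄ at e2 ⊢
    field_simp
    linear_combination S11 (A/2) μ * deriv (fun x => S20 x μ) (A/2) * E ^ 2 * e1 -
      deriv (fun x => S11 x μ) (A/2) * S20 (A/2) μ * E ^ 2 * e2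
end

section
/- Fix λ ∈ ℝ \ {0} and A > 0. Let q be an admissible potential on (0,A) equipped with a normalized fundamental system, with associated characteristic function Δ and function δ. Then there exists a constant C > 0 such that |Δ(μ)| ≤ C·e^{A·|Re(μ)|} and |δ(μ)| ≤ C·e^{A·|Re(μ)|} for all μ ∈ ℂ; in particular, |Δ(iy)| ≤ C and |δ(iy)| ≤ C for all y ∈ ℝ. -/
open Filter MeasureTheory Topology

/-- Gronwall's inequality in differential form, with the antiderivative of the coefficient given. -/
lemma le_mul_exp_sub_of_deriv_le_mul {E E' κ κ' : ℝ → ℝ} {a b : ℝ} (hab : a ≤ b)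
    (hE : ∀ x ∈ Set.Icc a b, HasDerivAt E (E' x) x)
    (hκ : ∀ x ∈ Set.Icc a b, HasDerivAt κ (κ' x) x)
    (h : ∀ x ∈ Set.Icc a b, E' x ≤ κ' x * E x) :
    E b ≤ E a * Real.exp (κ b - κ a) := by
  have hF : ∀ x ∈ Set.Icc a b, HasDerivAt (fun x => E x * Real.exp (-κ x))
      (E' x * Real.exp (-κ x) + E x * (Real.exp (-κ x) * -κ' x)) x :=
    fun x hx => (hE x hx).mul (hκ x hx).neg.exp
  have hanti : AntitoneOn (fun x => E x * Real.exp (-κ x)) (Set.Icc a b) := by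
    refine antitoneOn_of_deriv_nonpos (convex_Icc a b)
      (fun x hx => (hF x hx).continuousAt.continuousWithinAt)
      (fun x hx => (hF x (interior_subset hx)).differentiableAt.differentiableWithinAt) ?_
    intro x hx
    have hx' := interior_subset hx
    rw [(hF x hx').deriv]
    nlinarith [h x hx', Real.exp_pos (-κ x)]
  have key : E b * Real.exp (-κ b) ≤ E a * Real.exp (-κ a) :=
    hanti (Set.left_mem_Icc.2 hab) (Set.right_mem_Icc.2 hab) hab
  have h2 := mul_le_mul_of_nonneg_right key (Real.exp_pos (κ b)).le
  rw [mul_assoc, mul_assoc, ← Real.exp_add, ← Real.exp_add] at h2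
  simpa [sub_eq_add_neg, add_comm] using h2

/-- A curve whose speed is dominated by the derivative of `κ` moves by at most the increment
of `κ`. -/
lemma norm_sub_le_sub_of_norm_deriv_le {f f' : ℝ → ℂ} {κ κ' : ℝ → ℝ} {a b : ℝ} (hab : a ≤ b)
    (hf : ∀ x ∈ Set.Icc a b, HasDerivAt f (f' x) x)
    (hκ : ∀ x ∈ Set.Icc a b, HasDerivAt κ (κ' x) x)
    (h : ∀ x ∈ Set.Icc a b, ‖f' x‖ ≤ κ' x) :
    ‖f b - f a‖ ≤ κ b - κ a := by
  refine image_norm_le_of_norm_deriv_right_le_deriv_boundary' (f := fun x => f x - f a) (f' := f')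
    (B := fun x => κ x - κ a) (B' := κ') (a := a) (b := b)
    (fun x hx => ((hf x hx).sub_const _).continuousAt.continuousWithinAt)
    (fun x hx => ((hf x (Set.Ico_subset_Icc_self hx)).sub_const _).hasDerivWithinAt)
    (by simp)
    (fun x hx => ((hκ x hx).sub_const _).continuousAt.continuousWithinAt)
    (fun x hx => ((hκ x (Set.Ico_subset_Icc_self hx)).sub_const _).hasDerivWithinAt)
    (fun x hx => h x (Set.Ico_subset_Icc_self hx)) (Set.right_mem_Icc.2 hab)

/-- A nonnegative continuous function on an open interval has an antiderivative whose increments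
over subintervals of `s` are bounded when the function is integrable on `s`. -/
lemma exists_antideriv_bounded_increments {A : ℝ} (hA : 0 < A) {k : ℝ → ℝ} {s : Set ℝ}
    (hk : ContinuousOn k (Set.Ioo 0 A)) (hs : IntegrableOn k s) (hms : MeasurableSet s)
    (hpos : ∀ x ∈ s, 0 ≤ k x) :
    ∃ (Q : ℝ → ℝ) (K : ℝ), 0 ≤ K ∧ (∀ x ∈ Set.Ioo 0 A, HasDerivAt Q (k x) x) ∧
      ∀ a ∈ Set.Ioo 0 A, ∀ b ∈ Set.Ioo 0 A, a ≤ b → Set.Ioo a b ⊆ s → Q b - Q a ≤ K := by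
  have hmid : A / 2 ∈ Set.Ioo 0 A := ⟨by linarith, by linarith⟩
  have hii : ∀ a ∈ Set.Ioo 0 A, ∀ b ∈ Set.Ioo 0 A, IntervalIntegrable k volume a b :=
    fun a ha b hb => (hk.mono (Set.ordConnected_Ioo.uIcc_subset ha hb)).intervalIntegrable
  refine ⟨fun x => ∫ t in (A / 2)..x, k t, ∫ t in s, k t, setIntegral_nonneg hms hpos, ?_, ?_⟩
  · intro x hx
    exact intervalIntegral.integral_hasDerivAt_right (hii _ hmid _ hx)
      (hk.stronglyMeasurableAtFilter isOpen_Ioo x hx) (hk.continuousAt (isOpen_Ioo.mem_nhds hx))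
  · intro a ha b hb hab hsub
    rw [intervalIntegral.integral_interval_sub_left (hii _ hmid _ hb) (hii _ hmid _ ha),
      intervalIntegral.integral_of_le hab, integral_Ioc_eq_integral_Ioo]
    refine setIntegral_mono_set hs ?_ hsub.eventuallyLE
    exact (ae_restrict_mem hms).mono hpos

/-- Energy estimate away from the singularity, where `μ²` dominates. -/
lemma energy_le_of_dominant_spectral {c m a b : ℝ} {μ : ℂ} {q₀ u u' : ℝ → ℂ} {Q : ℝ → ℝ} {d : ℂ}
    (hm : 0 < m) (hμ : ‖μ‖ = m) (ha : a = 1 / m) (hab : a ≤ b) (hd : ‖d‖ = c)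
    (hu : ∀ x ∈ Set.Icc a b, HasDerivAt u (u' x) x)
    (hu' : ∀ x ∈ Set.Icc a b, HasDerivAt u' ((μ ^ 2 + d / (x : ℂ) ^ 2 + q₀ x) * u x) x)
    (hQ : ∀ x ∈ Set.Icc a b, HasDerivAt Q (x * ‖q₀ x‖) x) :
    ‖u' b‖ ^ 2 + m ^ 2 * ‖u b‖ ^ 2 ≤
      (‖u' a‖ ^ 2 + m ^ 2 * ‖u a‖ ^ 2) *
        Real.exp (2 * |μ.re| * b + c + (Q b - Q a)) := by
  have ha0 : 0 < a := by rw [ha]; positivity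
  have hc : 0 ≤ c := hd ▸ norm_nonneg _
  have h1 := le_mul_exp_sub_of_deriv_le_mul (a := a) (b := b)
    (E := fun x => ‖u' x‖ ^ 2 + m ^ 2 * ‖u x‖ ^ 2)
    (κ := fun x => 2 * |μ.re| * x - c / m * x⁻¹ + Q x)
    (κ' := fun x => 2 * |μ.re| * 1 - c / m * (-(x ^ 2)⁻¹) + x * ‖q₀ x‖) hab
    (fun x hx => (hu' x hx).norm_sq.add ((hu x hx).norm_sq.const_mul (m ^ 2)))
    (fun x hx => (((hasDerivAt_id x).const_mul _).sub
      ((hasDerivAt_inv (ha0.trans_le hx.1).ne').const_mul _)).add (hQ x hx)) ?_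
  · refine h1.trans (mul_le_mul_of_nonneg_left (Real.exp_le_exp.2 ?_) (by positivity))
    have hb : 0 ≤ c / m * b⁻¹ := by have := ha0.trans_le hab; positivity
    have h2 : c / m * a⁻¹ = c := by rw [ha]; field_simp
    have h3 : 0 ≤ 2 * |μ.re| * a := by positivity
    linarith
  · intro x hx
    have hx0 : 0 < x := ha0.trans_le hx.1
    have hmx : 1 ≤ m * x := by
      have := mul_le_mul_of_nonneg_left hx.1 hm.le
      rwa [ha, mul_one_div_cancel hm.ne'] at this
    have hsplit : inner ℝ (u' x) ((μ ^ 2 + d / (x : ℂ) ^ 2 + q₀ x) * u x)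
          + m ^ 2 * inner ℝ (u x) (u' x)
        = inner ℝ (u' x) (((2 * μ.re : ℝ) : ℂ) * μ * u x)
          + inner ℝ (u' x) ((d / (x : ℂ) ^ 2 + q₀ x) * u x) := by
      have hm2 : m ^ 2 = μ.re ^ 2 + μ.im ^ 2 := by
        rw [← hμ, Complex.sq_norm, Complex.normSq_apply]; ring
      rw [add_assoc (μ ^ 2), add_mul (μ ^ 2), inner_add_right, hm2]
      simp only [Complex.inner, pow_two, Complex.mul_re, Complex.mul_im, Complex.conj_re,
        Complex.conj_im, Complex.ofReal_re, Complex.ofReal_im]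
      ring
    have hb1 : inner ℝ (u' x) (((2 * μ.re : ℝ) : ℂ) * μ * u x)
        ≤ 2 * |μ.re| * (‖u' x‖ * (m * ‖u x‖)) := by
      refine (real_inner_le_norm _ _).trans_eq ?_
      rw [norm_mul, norm_mul, Complex.norm_real, Real.norm_eq_abs, abs_mul, abs_two, hμ]; ring
    have hb2 : inner ℝ (u' x) ((d / (x : ℂ) ^ 2 + q₀ x) * u x)
        ≤ (c / m * (x ^ 2)⁻¹ + x * ‖q₀ x‖) * (‖u' x‖ * (m * ‖u x‖)) := by
      refine (real_inner_le_norm _ _).trans ?_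
      have h1 : ‖d / (x : ℂ) ^ 2 + q₀ x‖ ≤ (c / m * (x ^ 2)⁻¹ + x * ‖q₀ x‖) * m := by
        refine (norm_add_le _ _).trans ?_
        rw [norm_div, norm_pow, Complex.norm_real, Real.norm_eq_abs, sq_abs, hd, add_mul]
        refine add_le_add (le_of_eq (by field_simp)) ?_
        nlinarith [norm_nonneg (q₀ x)]
      rw [norm_mul]
      calc ‖u' x‖ * (‖d / (x : ℂ) ^ 2 + q₀ x‖ * ‖u x‖)
          ≤ ‖u' x‖ * ((c / m * (x ^ 2)⁻¹ + x * ‖q₀ x‖) * m * ‖u x‖) := by gcongr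
        _ = _ := by ring
    have hamgm : 2 * (‖u' x‖ * (m * ‖u x‖)) ≤ ‖u' x‖ ^ 2 + m ^ 2 * ‖u x‖ ^ 2 := by
      nlinarith [sq_nonneg (‖u' x‖ - m * ‖u x‖)]
    have hcoef : 0 ≤ 2 * |μ.re| + (c / m * (x ^ 2)⁻¹ + x * ‖q₀ x‖) := by positivity
    have hfin := mul_le_mul_of_nonneg_left hamgm hcoef
    linarith

/-- Energy estimate near the singularity: a solution that is `O(√x)` at the origin has controlled
energy in the Liouville variables. -/
lemma liouville_energy_le {lam x₀ B K : ℝ} (hlam : lam ≠ 0) {μ : ℂ} {q₀ u u' : ℝ → ℂ}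
    {Q : ℝ → ℝ} (hx₀ : 0 < x₀) (hB : 0 ≤ B) (hK : 0 ≤ K) (hμ : ‖μ‖ * x₀ ≤ 1)
    (hu : ∀ x ∈ Set.Ioc 0 x₀, HasDerivAt u (u' x) x)
    (hu' : ∀ x ∈ Set.Ioc 0 x₀,
      HasDerivAt u' ((μ ^ 2 + (-(lam : ℂ) ^ 2 - 1/4) / (x : ℂ) ^ 2 + q₀ x) * u x) x)
    (hQ : ∀ x ∈ Set.Ioc 0 x₀, HasDerivAt Q (x * ‖q₀ x‖) x)
    (hQK : ∀ a ∈ Set.Ioc 0 x₀, ∀ b ∈ Set.Ioc 0 x₀, a ≤ b → Q b - Q a ≤ K)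
    (hbd : ∀ᶠ x in 𝓝[>] (0 : ℝ), ‖u x‖ ≤ B * √x) :
    ‖√x₀ • u' x₀ - (1 / 2 : ℝ) • (√x₀)⁻¹ • u x₀‖ ^ 2 + lam ^ 2 * ‖(√x₀)⁻¹ • u x₀‖ ^ 2 ≤
      ((4 * B + 2 * (B * (lam ^ 2 + K + 1))) ^ 2 + lam ^ 2 * B ^ 2) *
        Real.exp ((K + 1) / |lam|) := by
  set v : ℝ → ℂ := fun x => (√x)⁻¹ • u x with hv
  set w : ℝ → ℂ := fun x => √x • u' x - (1 / 2 : ℝ) • v x with hw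
  set p : ℝ → ℂ := fun x => μ ^ 2 + q₀ x with hp
  have hv' : ∀ x ∈ Set.Ioc 0 x₀, HasDerivAt v (x⁻¹ • w x) x := by
    intro x hx
    have h := ((Real.hasDerivAt_sqrt hx.1.ne').inv (Real.sqrt_pos.2 hx.1).ne').smul (hu x hx)
    refine h.congr_deriv ?_
    obtain ⟨s, hs, rfl⟩ : ∃ s : ℝ, 0 < s ∧ s ^ 2 = x :=
      ⟨√x, Real.sqrt_pos.2 hx.1, Real.sq_sqrt hx.1.le⟩
    have hsC : (s : ℂ) ≠ 0 := by exact_mod_cast hs.ne'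
    simp only [hw, hv, Pi.inv_apply, Real.sqrt_sq hs.le, Complex.real_smul]
    push_cast
    field_simp
    ring
  have hw' : ∀ x ∈ Set.Ioc 0 x₀,
      HasDerivAt w ((-(lam ^ 2 / x)) • v x + (x : ℂ) * p x * v x) x := by
    intro x hx
    have h := ((Real.hasDerivAt_sqrt hx.1.ne').smul (hu' x hx)).sub
      ((hv' x hx).const_smul (1 / 2 : ℝ))
    refine h.congr_deriv ?_
    obtain ⟨s, hs, rfl⟩ : ∃ s : ℝ, 0 < s ∧ s ^ 2 = x :=
      ⟨√x, Real.sqrt_pos.2 hx.1, Real.sq_sqrt hx.1.le⟩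
    have hsC : (s : ℂ) ≠ 0 := by exact_mod_cast hs.ne'
    simp only [hw, hv, hp, Real.sqrt_sq hs.le, Complex.real_smul]
    push_cast
    field_simp
    ring
  have hpn : ∀ x, ‖p x‖ ≤ ‖μ‖ ^ 2 + ‖q₀ x‖ := fun x =>
    (norm_add_le _ _).trans_eq (by rw [norm_pow])
  have hQμ : ∀ x ∈ Set.Ioc 0 x₀, HasDerivAt (fun x => Q x + ‖μ‖ ^ 2 * x ^ 2 / 2)
      (x * ‖q₀ x‖ + ‖μ‖ ^ 2 * x) x := by
    intro x hx
    refine ((hQ x hx).add (((hasDerivAt_pow 2 x).const_mul (‖μ‖ ^ 2)).div_const 2)).congr_deriv ?_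
    norm_num
    ring
  have hinc : ∀ a ∈ Set.Ioc 0 x₀, ∀ b ∈ Set.Ioc 0 x₀, a ≤ b →
      (Q b + ‖μ‖ ^ 2 * b ^ 2 / 2) - (Q a + ‖μ‖ ^ 2 * a ^ 2 / 2) ≤ K + 1 := by
    intro a ha b hb hab
    have h1 : ‖μ‖ * b ≤ 1 := (mul_le_mul_of_nonneg_left hb.2 (norm_nonneg _)).trans hμ
    have h2 : 0 ≤ ‖μ‖ * b := mul_nonneg (norm_nonneg _) hb.1.le
    nlinarith [hQK a ha b hb hab, sq_nonneg (‖μ‖ * a)]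
  obtain ⟨ε, hε, hεB⟩ := mem_nhdsGT_iff_exists_Ioc_subset.1 hbd
  have hε0 : 0 < ε := hε
  set y := min ε x₀ / 2 with hy
  have hmin : 0 < min ε x₀ := lt_min hε0 hx₀
  have hy0 : 0 < y := by positivity
  have hyx : 2 * y ≤ x₀ := by rw [hy]; linarith [min_le_right ε x₀]
  have hyε : 2 * y ≤ ε := by rw [hy]; linarith [min_le_left ε x₀]
  have hmem : ∀ x ∈ Set.Icc y (2 * y), x ∈ Set.Ioc 0 x₀ := fun x hx =>
    ⟨hy0.trans_le hx.1, hx.2.trans hyx⟩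
  have hvB : ∀ x ∈ Set.Icc y (2 * y), ‖v x‖ ≤ B := by
    intro x hx
    have h0 := hy0.trans_le hx.1
    have hs := Real.sqrt_pos.2 h0
    have h1 : ‖u x‖ ≤ B * √x := hεB ⟨h0, hx.2.trans hyε⟩
    rw [hv, norm_smul, norm_inv, Real.norm_eq_abs, abs_of_pos hs, inv_mul_le_iff₀ hs]
    linarith
  set D := B * (lam ^ 2 + K + 1) with hD
  have hlog2 : Real.log 2 ≤ 1 := by linarith [Real.log_two_lt_d9]
  have hwD : ∀ x ∈ Set.Icc y (2 * y), ‖w x - w y‖ ≤ D := by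
    intro x hx
    have hsub : ∀ t ∈ Set.Icc y x, t ∈ Set.Icc y (2 * y) := fun t ht => ⟨ht.1, ht.2.trans hx.2⟩
    refine (norm_sub_le_sub_of_norm_deriv_le hx.1 (fun t ht => hw' t (hmem t (hsub t ht)))
      (κ := fun t => B * (lam ^ 2 * Real.log t + (Q t + ‖μ‖ ^ 2 * t ^ 2 / 2)))
      (fun t ht => (((Real.hasDerivAt_log (hy0.trans_le ht.1).ne').const_mul _).add
        (hQμ t (hmem t (hsub t ht)))).const_mul B) ?_).trans ?_
    · intro t ht
      have ht0 := hy0.trans_le ht.1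
      have h1 := hvB t (hsub t ht)
      refine (norm_add_le _ _).trans ?_
      rw [norm_smul, norm_mul, norm_mul, Complex.norm_real, Real.norm_eq_abs, Real.norm_eq_abs,
        abs_neg, abs_of_pos ht0, abs_of_nonneg (by positivity)]
      calc lam ^ 2 / t * ‖v t‖ + t * ‖p t‖ * ‖v t‖
          ≤ lam ^ 2 / t * B + t * (‖μ‖ ^ 2 + ‖q₀ t‖) * B := by gcongr; exact hpn t
        _ = _ := by ring
    · have h1 : Real.log x ≤ Real.log y + Real.log 2 := by
        rw [← Real.log_mul hy0.ne' two_ne_zero, mul_comm]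
        exact Real.log_le_log (hy0.trans_le hx.1) hx.2
      have h2 := hinc y (hmem y ⟨le_rfl, by linarith⟩) x (hmem x hx) hx.1
      have h3 : lam ^ 2 * (Real.log x - Real.log y) ≤ lam ^ 2 * 1 :=
        mul_le_mul_of_nonneg_left (by linarith) (sq_nonneg _)
      rw [← mul_sub, hD]
      refine mul_le_mul_of_nonneg_left ?_ hB
      linarith
  have hyI : y ∈ Set.Icc y (2 * y) := ⟨le_rfl, by linarith⟩
  have h2yI : 2 * y ∈ Set.Icc y (2 * y) := ⟨by linarith, le_rfl⟩
  have hwy : ‖w y‖ ≤ 4 * B + 2 * D := by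
    have h1 := norm_sub_le_sub_of_norm_deriv_le (a := y) (b := 2 * y) (by linarith)
      (f := fun x => v x - Real.log x • w y) (f' := fun x => x⁻¹ • w x - x⁻¹ • w y)
      (κ := fun x => D * y⁻¹ * x) (κ' := fun _ => D * y⁻¹ * 1)
      (fun x hx => (hv' x (hmem x hx)).sub
        ((Real.hasDerivAt_log (hy0.trans_le hx.1).ne').smul_const _))
      (fun x _ => (hasDerivAt_id x).const_mul _) ?_
    · have h2 : D * y⁻¹ * (2 * y) - D * y⁻¹ * y = D := by field_simp; ring
      rw [h2] at h1
      have h3 : v (2 * y) - Real.log (2 * y) • w y - (v y - Real.log y • w y)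
          = (v (2 * y) - v y) - Real.log 2 • w y := by
        rw [Real.log_mul two_ne_zero hy0.ne', add_smul]; abel
      rw [h3] at h1
      have h4 : ‖Real.log 2 • w y‖ ≤ ‖v (2 * y) - v y‖ + D := by
        have := norm_sub_norm_le (Real.log 2 • w y) (v (2 * y) - v y)
        rw [norm_sub_rev (Real.log 2 • w y)] at this
        linarith
      have h5 : ‖v (2 * y) - v y‖ ≤ B + B :=
        (norm_sub_le _ _).trans (add_le_add (hvB _ h2yI) (hvB _ hyI))
      rw [norm_smul, Real.norm_eq_abs, abs_of_pos (Real.log_pos one_lt_two)] at h4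
      nlinarith [Real.log_two_gt_d9, norm_nonneg (w y)]
    · intro x hx
      have hx0 := hy0.trans_le hx.1
      rw [← smul_sub, norm_smul, norm_inv, Real.norm_eq_abs, abs_of_pos hx0, mul_one, mul_comm]
      exact mul_le_mul (hwD x hx) (inv_anti₀ hy0 hx.1) (by positivity) (by positivity)
  have hmem' : ∀ x ∈ Set.Icc y x₀, x ∈ Set.Ioc 0 x₀ := fun x hx => ⟨hy0.trans_le hx.1, hx.2⟩
  have hlam' : 0 < |lam| := abs_pos.2 hlam
  have hmain := le_mul_exp_sub_of_deriv_le_mul (a := y) (b := x₀) (by linarith)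
    (E := fun x => ‖w x‖ ^ 2 + lam ^ 2 * ‖v x‖ ^ 2)
    (κ := fun x => (Q x + ‖μ‖ ^ 2 * x ^ 2 / 2) / |lam|)
    (fun x hx => (hw' x (hmem' x hx)).norm_sq.add
      ((hv' x (hmem' x hx)).norm_sq.const_mul (lam ^ 2)))
    (fun x hx => (hQμ x (hmem' x hx)).div_const |lam|) ?_
  · refine hmain.trans ?_
    have hvy := hvB y hyI
    rw [← sub_div]
    have := hinc y (hmem y hyI) x₀ ⟨hx₀, le_rfl⟩ (by linarith)
    gcongr
  · intro x hx
    have hx0 := hy0.trans_le hx.1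
    have hcancel : inner ℝ (w x) ((-(lam ^ 2 / x)) • v x + (x : ℂ) * p x * v x)
        + lam ^ 2 * inner ℝ (v x) (x⁻¹ • w x) = inner ℝ (w x) ((x : ℂ) * p x * v x) := by
      rw [inner_add_right, real_inner_smul_right (w x) (v x), real_inner_smul_right (v x) (w x),
        real_inner_comm (w x) (v x)]
      ring
    have hb : inner ℝ (w x) ((x : ℂ) * p x * v x)
        ≤ (x * ‖q₀ x‖ + ‖μ‖ ^ 2 * x) / |lam| * (‖w x‖ * (|lam| * ‖v x‖)) := by
      refine (real_inner_le_norm _ _).trans ?_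
      rw [norm_mul, norm_mul, Complex.norm_real, Real.norm_eq_abs, abs_of_pos hx0]
      calc ‖w x‖ * (x * ‖p x‖ * ‖v x‖)
          ≤ ‖w x‖ * (x * (‖μ‖ ^ 2 + ‖q₀ x‖) * ‖v x‖) := by gcongr; exact hpn x
        _ = _ := by field_simp; ring
    have hamgm : 2 * (‖w x‖ * (|lam| * ‖v x‖)) ≤ ‖w x‖ ^ 2 + lam ^ 2 * ‖v x‖ ^ 2 := by
      nlinarith [sq_nonneg (‖w x‖ - |lam| * ‖v x‖), sq_abs lam]
    have hcoef : 0 ≤ (x * ‖q₀ x‖ + ‖μ‖ ^ 2 * x) / |lam| := by positivity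
    have hfin := mul_le_mul_of_nonneg_left hamgm hcoef
    linarith

/-- The energy at `1 / m` in terms of the energy in the Liouville variables. -/
lemma energy_le_of_liouville_energy_le {lam m C : ℝ} {z z' : ℂ} (hlam : lam ≠ 0) (hm : 0 < m)
    (h : ‖√(1 / m) • z' - (1 / 2 : ℝ) • (√(1 / m))⁻¹ • z‖ ^ 2
      + lam ^ 2 * ‖(√(1 / m))⁻¹ • z‖ ^ 2 ≤ C) :
    ‖z'‖ ^ 2 + m ^ 2 * ‖z‖ ^ 2 ≤ (2 + 2 / lam ^ 2) * C * m := by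
  have hx₀ : 0 < 1 / m := by positivity
  have hl2 : 0 < lam ^ 2 := by positivity
  set s := √(1 / m) with hs
  have hs0 : 0 < s := Real.sqrt_pos.2 hx₀
  have hsm : s ^ 2 * m = 1 := by
    rw [hs, Real.sq_sqrt hx₀.le]; field_simp
  set V := s⁻¹ • z with hV
  set W := s • z' - (1 / 2 : ℝ) • V with hW
  have h1 : ‖z‖ = s * ‖V‖ := by
    rw [hV, norm_smul, norm_inv, Real.norm_eq_abs, abs_of_pos hs0]; field_simp
  have h2 : s * ‖z'‖ ≤ ‖W‖ + 1 / 2 * ‖V‖ := by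
    have : s • z' = W + (1 / 2 : ℝ) • V := by rw [hW]; abel
    calc s * ‖z'‖ = ‖s • z'‖ := by
          rw [norm_smul, Real.norm_eq_abs, abs_of_pos hs0]
      _ ≤ ‖W‖ + ‖(1 / 2 : ℝ) • V‖ := by rw [this]; exact norm_add_le _ _
      _ = _ := by rw [norm_smul]; norm_num
  have h3 : (s * ‖z'‖) ^ 2 ≤ 2 * ‖W‖ ^ 2 + ‖V‖ ^ 2 := by
    have h0 : 0 ≤ s * ‖z'‖ := by positivity
    nlinarith [sq_nonneg (‖W‖ - 1 / 2 * ‖V‖), norm_nonneg V, norm_nonneg W,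
      mul_self_le_mul_self h0 h2]
  have h4 : ‖z'‖ ^ 2 = m * (s * ‖z'‖) ^ 2 := by
    linear_combination (-‖z'‖ ^ 2) * hsm
  have h5 : m ^ 2 * ‖z‖ ^ 2 = m * ‖V‖ ^ 2 := by
    rw [h1]; linear_combination (m * ‖V‖ ^ 2) * hsm
  have h6 : 2 * ‖W‖ ^ 2 + 2 * ‖V‖ ^ 2 ≤ (2 + 2 / lam ^ 2) * C := by
    have h7 : ‖V‖ ^ 2 ≤ C / lam ^ 2 := by
      rw [le_div_iff₀ hl2]; nlinarith [sq_nonneg ‖W‖]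
    have h8 : ‖W‖ ^ 2 ≤ C := by nlinarith [mul_nonneg hl2.le (sq_nonneg ‖V‖)]
    have h9 : (2 + 2 / lam ^ 2) * C = 2 * C + 2 * (C / lam ^ 2) := by ring
    linarith
  rw [h4, h5, ← mul_add, mul_comm _ m]
  exact mul_le_mul_of_nonneg_left (by linarith) hm.le

/-- Uniform energy bound at the midpoint for solutions that are `O(√x)` at the origin. -/
lemma exists_midpoint_energy_bound {lam A B : ℝ} (hlam : lam ≠ 0) (hA : 0 < A) (hB : 0 ≤ B)
    {K : ℝ} (hK : 0 ≤ K) {q₀ : ℝ → ℂ} {Q : ℝ → ℝ}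
    (hQ : ∀ x ∈ Set.Ioo 0 A, HasDerivAt Q (x * ‖q₀ x‖) x)
    (hQK : ∀ a b, 0 < a → a ≤ b → b ≤ A / 2 → Q b - Q a ≤ K) :
    ∃ C : ℝ, 0 < C ∧ ∀ (μ : ℂ) (u u' : ℝ → ℂ),
      (∀ x ∈ Set.Ioo 0 A, HasDerivAt u (u' x) x) →
      (∀ x ∈ Set.Ioo 0 A,
        HasDerivAt u' ((μ ^ 2 + (-(lam : ℂ) ^ 2 - 1/4) / (x : ℂ) ^ 2 + q₀ x) * u x) x) →
      (∀ᶠ x in 𝓝[>] (0 : ℝ), ‖u x‖ ≤ B * √x) →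
      ‖u' (A / 2)‖ ^ 2 + max ‖μ‖ (2 / A) ^ 2 * ‖u (A / 2)‖ ^ 2 ≤
        C * max ‖μ‖ (2 / A) * Real.exp (A * |μ.re|) := by
  set C₁ := ((4 * B + 2 * (B * (lam ^ 2 + K + 1))) ^ 2 + lam ^ 2 * B ^ 2) *
        Real.exp ((K + 1) / |lam|) with hC₁
  set c := ‖(-(lam : ℂ) ^ 2 - 1/4)‖ with hc
  set C₂ := (2 + 2 / lam ^ 2) * C₁ with hC₂
  have hC₁0 : 0 ≤ C₁ := by positivity
  have hC₂0 : 0 ≤ C₂ := by positivity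
  refine ⟨C₂ * Real.exp (c + K) + 1, by positivity, ?_⟩
  intro μ u u' hu hu' hbd
  set m := max ‖μ‖ (2 / A) with hm
  have hm0 : 0 < m := lt_max_of_lt_right (by positivity)
  have hmA : 1 / m ≤ A / 2 := by
    rw [div_le_iff₀ hm0]
    have : 2 / A ≤ m := le_max_right _ _
    calc (1 : ℝ) = A / 2 * (2 / A) := by field_simp
      _ ≤ A / 2 * m := by gcongr
  have hx₀ : 0 < 1 / m := by positivity
  have hμm : ‖μ‖ * (1 / m) ≤ 1 := by
    rw [mul_one_div, div_le_one hm0]; exact le_max_left _ _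
  have hsub : ∀ x ∈ Set.Ioc 0 (1 / m), x ∈ Set.Ioo 0 A := fun x hx =>
    ⟨hx.1, by linarith [hx.2]⟩
  have hE₁ := liouville_energy_le hlam hx₀ hB hK hμm (fun x hx => hu x (hsub x hx))
    (fun x hx => hu' x (hsub x hx)) (fun x hx => hQ x (hsub x hx))
    (fun a ha b hb hab => hQK a b ha.1 hab (hb.2.trans hmA)) hbd
  rw [← hC₁] at hE₁
  have hE₂ : ‖u' (1 / m)‖ ^ 2 + m ^ 2 * ‖u (1 / m)‖ ^ 2 ≤ C₂ * m :=
    energy_le_of_liouville_energy_le hlam hm0 hE₁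
  have hexp : 1 ≤ Real.exp (A * |μ.re|) := Real.one_le_exp (by positivity)
  have hexp' : 1 ≤ Real.exp (c + K) := Real.one_le_exp (by positivity)
  rcases le_total (2 / A) ‖μ‖ with h | h
  · have hmμ : ‖μ‖ = m := by rw [hm, max_eq_left h]
    have hsub' : ∀ x ∈ Set.Icc (1 / m) (A / 2), x ∈ Set.Ioo 0 A := fun x hx =>
      ⟨hx₀.trans_le hx.1, by linarith [hx.2]⟩
    refine (energy_le_of_dominant_spectral hm0 hmμ rfl hmA hc.symm
      (fun x hx => hu x (hsub' x hx)) (fun x hx => hu' x (hsub' x hx))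
      (fun x hx => hQ x (hsub' x hx))).trans ?_
    have hexp2 : Real.exp (2 * |μ.re| * (A / 2) + c + (Q (A / 2) - Q (1 / m))) ≤
        Real.exp (c + K) * Real.exp (A * |μ.re|) := by
      rw [← Real.exp_add, Real.exp_le_exp]
      linarith [hQK (1 / m) (A / 2) hx₀ hmA le_rfl]
    calc _ ≤ C₂ * m * (Real.exp (c + K) * Real.exp (A * |μ.re|)) := by gcongr
      _ = C₂ * Real.exp (c + K) * m * Real.exp (A * |μ.re|) := by ring
      _ ≤ _ := by gcongr; linarith
  · have hmA' : 1 / m = A / 2 := by rw [hm, max_eq_right h]; field_simp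
    rw [hmA'] at hE₂
    refine hE₂.trans ?_
    calc C₂ * m ≤ (C₂ * Real.exp (c + K) + 1) * m := by gcongr; nlinarith
      _ ≤ _ := le_mul_of_one_le_right (by positivity) hexp

/-- The Wronskian of two solutions is controlled by their energies. -/
lemma norm_wronskian_le {m M : ℝ} {a a' b b' : ℂ} (hm : 0 < m)
    (ha : ‖a'‖ ^ 2 + m ^ 2 * ‖a‖ ^ 2 ≤ M * m) (hb : ‖b'‖ ^ 2 + m ^ 2 * ‖b‖ ^ 2 ≤ M * m) :
    ‖a * b' - a' * b‖ ≤ M := by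
  have h1 : ‖a * b' - a' * b‖ ≤ ‖a‖ * ‖b'‖ + ‖a'‖ * ‖b‖ := by
    simpa using norm_sub_le (a * b') (a' * b)
  have h2 : m * (‖a‖ * ‖b'‖ + ‖a'‖ * ‖b‖) ≤ m * M := by
    nlinarith [sq_nonneg (m * ‖a‖ - ‖b'‖), sq_nonneg (m * ‖b‖ - ‖a'‖)]
  exact h1.trans (le_of_mul_le_mul_left h2 hm)

/-- The normalization at the origin bounds the solution by a multiple of `√x`. -/
lemma eventually_norm_le_sqrt_of_tendsto {f : ℝ → ℂ} {r : ℝ} {d : ℂ} (hd : d ≠ 0)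
    (h : Tendsto (fun x : ℝ => d * f x * (x : ℂ) ^ ((-1/2 : ℂ) + Complex.I * r))
      (𝓝[>] 0) (𝓝 1)) :
    ∀ᶠ x in 𝓝[>] (0 : ℝ), ‖f x‖ ≤ 2 / ‖d‖ * √x := by
  have h1 : ∀ᶠ x in 𝓝[>] (0 : ℝ),
      ‖d * f x * (x : ℂ) ^ ((-1/2 : ℂ) + Complex.I * r)‖ < 2 :=
    h.norm.eventually (gt_mem_nhds (by norm_num))
  filter_upwards [h1, self_mem_nhdsWithin] with x hx hx0
  have hx0 : 0 < x := hx0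
  have hs := Real.sqrt_pos.2 hx0
  have hd' := norm_pos_iff.2 hd
  have hre : ((-1/2 : ℂ) + Complex.I * r).re = -(1 / 2) := by simp; norm_num
  rw [norm_mul, norm_mul, Complex.norm_cpow_eq_rpow_re_of_pos hx0, hre,
    Real.rpow_neg hx0.le, ← Real.sqrt_eq_rpow, ← div_eq_mul_inv, div_lt_iff₀ hs] at hx
  rw [div_mul_eq_mul_div, le_div_iff₀ hd']
  linarith

lemma SolvesRadialODE.hasDerivAt {A : ℝ} {q : ℝ → ℂ} {μ : ℂ} {u : ℝ → ℂ}
    (h : SolvesRadialODE A q μ u) {x : ℝ} (hx : x ∈ Set.Ioo 0 A) :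
    HasDerivAt u (deriv u x) x ∧ HasDerivAt (deriv u) ((μ ^ 2 + q x) * u x) x := by
  obtain ⟨h1, h2, -, h3⟩ := h x hx
  refine ⟨h1.hasDerivAt, h2.hasDerivAt.congr_deriv ?_⟩
  linear_combination -h3

/-- The characteristic functions `Δ` and `δ` are of exponential type, with
`|Δ(μ)|, |δ(μ)| ≤ C e^{A|Re μ|}`; in particular they are bounded on the imaginary
axis. -/
theorem stmt17 (lam A : ℝ) (hlam : lam ≠ 0) (hA : 0 < A)
    (q : ℝ → ℂ) (S10 S20 S11 : ℝ → ℂ → ℂ)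
    (hq : IsAdmissible lam A q)
    (hS : IsNormalizedFS lam A q S10 S20 S11) :
    ∃ C : ℝ, 0 < C ∧
      (∀ μ : ℂ, ‖charFun A S10 S11 μ‖ ≤ C * Real.exp (A * |μ.re|) ∧
        ‖deltaFun A S20 S11 μ‖ ≤ C * Real.exp (A * |μ.re|)) ∧
      (∀ y : ℝ, ‖charFun A S10 S11 (Complex.I * y)‖ ≤ C ∧
        ‖deltaFun A S20 S11 (Complex.I * y)‖ ≤ C) := by
  obtain ⟨hqc, ⟨q₀, hq₀, hi₀⟩, ⟨q₁, hq₁, hi₁⟩⟩ := hq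
  obtain ⟨hode, -, hasym⟩ := hS
  have hlamC : (2 * Complex.I * lam : ℂ) ≠ 0 := by simp [hlam]
  have hq₀c : ContinuousOn (fun x : ℝ => x * ‖q₀ x‖) (Set.Ioo 0 A) := by
    have : ContinuousOn q₀ (Set.Ioo 0 A) := by
      refine ContinuousOn.congr (f := fun x : ℝ => q x - (-(lam : ℂ) ^ 2 - 1/4) / (x : ℂ) ^ 2)
        (hqc.sub (ContinuousOn.div continuousOn_const (by fun_prop) ?_)) ?_
      · intro x hx
        exact pow_ne_zero 2 (by exact_mod_cast hx.1.ne')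
      · intro x hx
        simp [hq₀ x hx]
    fun_prop
  have hq₁c : ContinuousOn (fun x : ℝ => (A - x) * ‖q₁ x‖) (Set.Ioo 0 A) := by
    have : ContinuousOn q₁ (Set.Ioo 0 A) := by
      refine ContinuousOn.congr
        (f := fun x : ℝ => q x - (-(lam : ℂ) ^ 2 - 1/4) / ((A : ℂ) - (x : ℂ)) ^ 2)
        (hqc.sub (ContinuousOn.div continuousOn_const (by fun_prop) ?_)) ?_
      · intro x hx
        exact pow_ne_zero 2 (sub_ne_zero.2 (by exact_mod_cast hx.2.ne'))
      · intro x hx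
        simp [hq₁ x hx]
    fun_prop
  obtain ⟨Q₀, K₀, hK₀, hQ₀, hQK₀⟩ := exists_antideriv_bounded_increments hA hq₀c hi₀
    measurableSet_Ioo (fun x hx => mul_nonneg hx.1.le (norm_nonneg _))
  obtain ⟨Q₁, K₁, hK₁, hQ₁, hQK₁⟩ := exists_antideriv_bounded_increments hA hq₁c hi₁
    measurableSet_Ioo (fun x hx => mul_nonneg (sub_nonneg.2 hx.2.le) (norm_nonneg _))
  have hrefl : ∀ x ∈ Set.Ioo 0 A, A - x ∈ Set.Ioo 0 A := fun x hx =>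
    ⟨by linarith [hx.2], by linarith [hx.1]⟩
  set B := max 2 (2 / ‖(2 * Complex.I * lam : ℂ)‖) with hB
  have hB0 : 0 ≤ B := le_max_of_le_left (by norm_num)
  obtain ⟨C₀, hC₀, hleft⟩ := exists_midpoint_energy_bound hlam hA hB0 hK₀ hQ₀ (by
    intro a b ha hab hb
    exact hQK₀ a ⟨ha, by linarith⟩ b ⟨by linarith, by linarith⟩ hab
      (Set.Ioo_subset_Ioo ha.le hb))
  obtain ⟨C₁, hC₁, hright⟩ := exists_midpoint_energy_bound (q₀ := fun x => q₁ (A - x))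
    (Q := fun x => -Q₁ (A - x)) hlam hA hB0 hK₁ (by
      intro x hx
      have h := ((hQ₁ (A - x) (hrefl x hx)).comp_const_sub A x).neg
      exact h.congr_deriv (by simp)) (by
      intro a b ha hab hb
      have := hQK₁ (A - b) ⟨by linarith, by linarith⟩ (A - a) ⟨by linarith, by linarith⟩
        (by linarith) (Set.Ioo_subset_Ioo (by linarith) (by linarith))
      linarith)
  have hbound : ∀ μ : ℂ, ‖charFun A S10 S11 μ‖ ≤ max C₀ C₁ * Real.exp (A * |μ.re|) ∧
      ‖deltaFun A S20 S11 μ‖ ≤ max C₀ C₁ * Real.exp (A * |μ.re|) := by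
    intro μ
    obtain ⟨h10, h20, h11⟩ := hode μ
    obtain ⟨a10, a20, a11⟩ := hasym μ
    set m := max ‖μ‖ (2 / A) with hm
    have hm0 : 0 < m := lt_max_of_lt_right (by positivity)
    have hL : ∀ u : ℝ → ℂ, SolvesRadialODE A q μ u →
        (∀ᶠ x in 𝓝[>] (0 : ℝ), ‖u x‖ ≤ B * √x) →
        ‖deriv u (A / 2)‖ ^ 2 + m ^ 2 * ‖u (A / 2)‖ ^ 2 ≤
          max C₀ C₁ * Real.exp (A * |μ.re|) * m := by
      intro u hu hbd
      refine (hleft μ u (deriv u) (fun x hx => (hu.hasDerivAt hx).1) (fun x hx => ?_) hbd).trans ?_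
      · refine (hu.hasDerivAt hx).2.congr_deriv ?_
        rw [hq₀ x hx]; ring
      · rw [mul_right_comm]
        gcongr
        exact le_max_left _ _
    have e10 := hL _ h10 (by
      have h := eventually_norm_le_sqrt_of_tendsto (f := fun x => S10 x μ) (r := lam)
        (d := 1) one_ne_zero (by simpa using a10)
      filter_upwards [h] with x hx
      refine hx.trans (mul_le_mul_of_nonneg_right ?_ (Real.sqrt_nonneg x))
      simp [hB])
    have e20 := hL _ h20 (by
      have h := eventually_norm_le_sqrt_of_tendsto (f := fun x => S20 x μ) (r := -lam)
        (d := 2 * Complex.I * lam) hlamC (by simpa [sub_eq_add_neg] using a20)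
      filter_upwards [h] with x hx
      exact hx.trans (mul_le_mul_of_nonneg_right (le_max_right _ _) (Real.sqrt_nonneg x)))
    have e11 : ‖deriv (fun x => S11 x μ) (A / 2)‖ ^ 2 + m ^ 2 * ‖S11 (A / 2) μ‖ ^ 2 ≤
        max C₀ C₁ * Real.exp (A * |μ.re|) * m := by
      have hlim : Tendsto (fun x : ℝ => A - x) (𝓝[>] 0) (𝓝[<] A) := by
        refine tendsto_nhdsWithin_iff.2 ⟨?_, ?_⟩
        · have : Tendsto (fun x : ℝ => A - x) (𝓝 0) (𝓝 (A - 0)) :=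
            (continuous_const.sub continuous_id).tendsto 0
          rw [sub_zero] at this
          exact this.mono_left nhdsWithin_le_nhds
        · filter_upwards [self_mem_nhdsWithin] with x hx
          exact sub_lt_self A hx
      have hbd : ∀ᶠ x in 𝓝[>] (0 : ℝ), ‖S11 (A - x) μ‖ ≤ B * √x := by
        have h := eventually_norm_le_sqrt_of_tendsto (f := fun x => S11 (A - x) μ) (r := lam)
          (d := 1) one_ne_zero (by simpa [Function.comp_def] using a11.comp hlim)
        filter_upwards [h] with x hx
        refine hx.trans (mul_le_mul_of_nonneg_right ?_ (Real.sqrt_nonneg x))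
        simp [hB]
      have h := hright μ (fun x => S11 (A - x) μ) (fun x => -deriv (fun x => S11 x μ) (A - x))
        (fun x hx => ((h11.hasDerivAt (hrefl x hx)).1).comp_const_sub A x) (fun x hx => ?_) hbd
      · rw [sub_half, norm_neg] at h
        refine h.trans ?_
        rw [mul_right_comm]
        gcongr
        exact le_max_right _ _
      · refine ((h11.hasDerivAt (hrefl x hx)).2.comp_const_sub A x).neg.congr_deriv ?_
        rw [hq₁ _ (hrefl x hx), neg_neg]
        push_cast
        rw [sub_sub_cancel]
        ring
    exact ⟨norm_wronskian_le hm0 e11 e10, norm_wronskian_le hm0 e11 e20⟩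
  refine ⟨max C₀ C₁, lt_max_of_lt_left hC₀, hbound, fun y => ?_⟩
  simpa using hbound (Complex.I * y)
end
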